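/- arXiv:1712.04552 — 4 statements merged into one kernel-verified Lean document; each statement's English description precedes it below -/
import Mathlib

section
/- Let d ≥ 1 and let F = (F_i)_{i∈I} be a finite indexed family of nonempty sets in ℝ^d with Helly number 2, i.e., every pairwise-intersecting subfamily of F has a common point. Let f : [2,∞) → [1,∞) be a differentiable function satisfying f'(x) ≥ (log₂ e)/x and f'(x)/f(x) ≤ 5/x for all x ≥ 2. Assume that for every integer p ≥ 2, every subfamily of F satisfying the (p,2)-property can be pierced by a finite set of at most p·f(p) points. Then for all integers p ≥ q ≥ 2 with q ≥ T₁₀₀(p), if F satisfies the (p,q)-property then F can be pierced by at most p − q + 1 points. -/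
/-- The `(p,q)`-property for a finite indexed family of sets. -/
def HasPQ {ι α : Type*} [Fintype ι] (F : ι → Set α) (p q : ℕ) : Prop :=
  p ≤ Fintype.card ι ∧
    ∀ J : Finset ι, J.card = p → ∃ K ⊆ J, K.card = q ∧ (⋂ k ∈ K, F k).Nonempty

/-- The `(p,q)`-property for the subfamily indexed by `S`. -/
def HasPQOn {ι α : Type*} (F : ι → Set α) (S : Finset ι) (p q : ℕ) : Prop :=
  p ≤ S.card ∧
    ∀ J ⊆ S, J.card = p → ∃ K ⊆ J, K.card = q ∧ (⋂ k ∈ K, F k).Nonempty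

/-- `P` pierces the family `F`: every member of `F` contains a point of `P`. -/
def Pierces {ι α : Type*} (F : ι → Set α) (P : Finset α) : Prop :=
  ∀ i, ∃ x ∈ P, x ∈ F i

section Piercing

variable {ι α : Type*}

/-- The members of `F` indexed by `S` can be pierced by at most `n` points. -/
def PierceableOn (F : ι → Set α) (S : Finset ι) (n : ℕ) : Prop :=
  ∃ P : Finset α, P.card ≤ n ∧ ∀ i ∈ S, ∃ x ∈ P, x ∈ F i

/-- The members of `F` indexed by `S` are pairwise disjoint. -/
def PairwiseDisjOn (F : ι → Set α) (S : Finset ι) : Prop :=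
  ∀ i ∈ S, ∀ j ∈ S, i ≠ j → ¬ (F i ∩ F j).Nonempty

/-- No point lies in more than `t` of the members of `F` indexed by `U`. -/
def DepthLE (F : ι → Set α) (U : Finset ι) (t : ℕ) : Prop :=
  ∀ K ⊆ U, (⋂ k ∈ K, F k).Nonempty → K.card ≤ t

/-- Some subfamily of depth at most `t ≤ k` has at least `m + t` members. -/
def HasShallow (F : ι → Set α) (S : Finset ι) (m k : ℕ) : Prop :=
  ∃ U ⊆ S, ∃ t ≤ k, m + t ≤ U.card ∧ DepthLE F U t

/-- The family has Helly number `2`. -/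
def HellyTwo (F : ι → Set α) : Prop :=
  ∀ S : Finset ι, (∀ i ∈ S, ∀ j ∈ S, (F i ∩ F j).Nonempty) → (⋂ i ∈ S, F i).Nonempty

variable {F : ι → Set α}

lemma PierceableOn.mono {S T : Finset ι} {m n : ℕ} (h : PierceableOn F T m) (hST : S ⊆ T)
    (hmn : m ≤ n) : PierceableOn F S n := by
  obtain ⟨P, hP, h⟩ := h
  exact ⟨P, hP.trans hmn, fun i hi => h i (hST hi)⟩

lemma PierceableOn.union [DecidableEq ι] {S T : Finset ι} {m n : ℕ} (hS : PierceableOn F S m)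
    (hT : PierceableOn F T n) : PierceableOn F (S ∪ T) (m + n) := by
  classical
  obtain ⟨P, hP, hS⟩ := hS
  obtain ⟨Q, hQ, hT⟩ := hT
  refine ⟨P ∪ Q, (Finset.card_union_le _ _).trans (add_le_add hP hQ), fun i hi => ?_⟩
  rcases Finset.mem_union.1 hi with hi | hi
  · obtain ⟨x, hx, hxi⟩ := hS i hi
    exact ⟨x, Finset.mem_union_left _ hx, hxi⟩
  · obtain ⟨x, hx, hxi⟩ := hT i hi
    exact ⟨x, Finset.mem_union_right _ hx, hxi⟩

lemma PierceableOn.of_coloring (helly : HellyTwo F) {S C : Finset ι} (g : ι → ι)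
    (hg : ∀ i ∈ S, g i ∈ C)
    (hgF : ∀ i ∈ S, ∀ j ∈ S, g i = g j → (F i ∩ F j).Nonempty) :
    PierceableOn F S C.card := by
  classical
  have h : ∀ v, (⋂ i ∈ S.filter (fun i => g i = v), F i).Nonempty := fun v => by
    apply helly
    intro i hi j hj
    rw [Finset.mem_filter] at hi hj
    exact hgF i hi.1 j hj.1 (hi.2.trans hj.2.symm)
  choose x hx using h
  refine ⟨C.image x, Finset.card_image_le, fun i hi => ?_⟩
  refine ⟨x (g i), Finset.mem_image_of_mem _ (hg i hi), ?_⟩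
  exact Set.mem_iInter₂.1 (hx (g i)) i (Finset.mem_filter.2 ⟨hi, rfl⟩)

lemma pierceableOn_card (hne : ∀ i, (F i).Nonempty) (S : Finset ι) :
    PierceableOn F S S.card := by
  classical
  choose x hx using hne
  exact ⟨S.image x, Finset.card_image_le, fun i hi => ⟨x i, Finset.mem_image_of_mem _ hi, hx i⟩⟩

lemma DepthLE.union [DecidableEq ι] {U V : Finset ι} {s t : ℕ} (hU : DepthLE F U s)
    (hV : DepthLE F V t) : DepthLE F (U ∪ V) (s + t) := by
  intro K hK hne
  have hsub : K ⊆ (K ∩ U) ∪ (K ∩ V) := by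
    rw [← Finset.inter_union_distrib_left]
    exact Finset.subset_inter subset_rfl hK
  have key : ∀ L ⊆ K, (⋂ k ∈ L, F k).Nonempty := fun L hL =>
    hne.mono (Set.biInter_subset_biInter_left hL)
  calc K.card ≤ (K ∩ U).card + (K ∩ V).card :=
        (Finset.card_le_card hsub).trans (Finset.card_union_le _ _)
    _ ≤ s + t := add_le_add
        (hU _ Finset.inter_subset_right (key _ Finset.inter_subset_left))
        (hV _ Finset.inter_subset_right (key _ Finset.inter_subset_left))

lemma DepthLE.mono {U V : Finset ι} {s t : ℕ} (hV : DepthLE F V s) (hUV : U ⊆ V) (hst : s ≤ t) :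
    DepthLE F U t :=
  fun K hK hne => (hV K (hK.trans hUV) hne).trans hst

lemma depthLE_card (U : Finset ι) : DepthLE F U U.card :=
  fun _ hK _ => Finset.card_le_card hK

lemma PairwiseDisjOn.depthLE {U : Finset ι} (hU : PairwiseDisjOn F U) : DepthLE F U 1 := by
  rintro K hK ⟨x, hx⟩
  rw [Set.mem_iInter₂] at hx
  rw [Finset.card_le_one]
  intro i hi j hj
  by_contra hij
  exact hU i (hK hi) j (hK hj) hij ⟨x, hx i hi, hx j hj⟩

lemma HasShallow.zero (S : Finset ι) (k : ℕ) : HasShallow F S 0 k :=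
  ⟨∅, Finset.empty_subset _, 0, Nat.zero_le _, by simp, by simpa using depthLE_card (F := F) ∅⟩

/-- A maximum pairwise disjoint subfamily. -/
lemma exists_max_pairwiseDisjOn (F : ι → Set α) (S : Finset ι) :
    ∃ C ⊆ S, PairwiseDisjOn F C ∧ ∀ E ⊆ S, PairwiseDisjOn F E → E.card ≤ C.card := by
  classical
  obtain ⟨C, hC, hmax⟩ := Finset.exists_max_image
    (S.powerset.filter (fun E => PairwiseDisjOn F E)) Finset.card
    ⟨∅, Finset.mem_filter.2 ⟨Finset.empty_mem_powerset S, fun i hi => by simp at hi⟩⟩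
  rw [Finset.mem_filter, Finset.mem_powerset] at hC
  exact ⟨C, hC.1, hC.2, fun E hE hEd =>
    hmax E (Finset.mem_filter.2 ⟨Finset.mem_powerset.2 hE, hEd⟩)⟩

lemma PierceableOn.half_card [DecidableEq ι] (hne : ∀ i, (F i).Nonempty) (helly : HellyTwo F)
    {c : ℕ} (U : Finset ι) (hc : ∀ E ⊆ U, PairwiseDisjOn F E → E.card ≤ c) :
    PierceableOn F U ((U.card + c) / 2) := by
  induction U using Finset.strongInduction with
  | H U ih =>
    by_cases hU : PairwiseDisjOn F U
    · have := hc U subset_rfl hU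
      exact (pierceableOn_card hne U).mono subset_rfl (by omega)
    · simp only [PairwiseDisjOn, not_forall, not_not] at hU
      obtain ⟨i, hi, j, hj, hij, hinter⟩ := hU
      have hsub : ({i, j} : Finset ι) ⊆ U := by
        simp [Finset.insert_subset_iff, hi, hj]
      have hcard : ({i, j} : Finset ι).card = 2 := Finset.card_pair hij
      have hrest := ih (U \ {i, j}) (Finset.sdiff_ssubset hsub ⟨i, by simp⟩)
        (fun E hE => hc E (hE.trans Finset.sdiff_subset))
      have hpair : PierceableOn F ({i, j} : Finset ι) ({i} : Finset ι).card := by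
        refine PierceableOn.of_coloring helly (fun _ => i) (by simp) ?_
        have hinter' : (F j ∩ F i).Nonempty := by rwa [Set.inter_comm]
        simp [hinter, hinter', hne]
      have h := hpair.union hrest
      rw [Finset.union_sdiff_of_subset hsub] at h
      have h2 := Finset.card_sdiff_add_card_eq_card hsub
      refine h.mono subset_rfl ?_
      rw [Finset.card_singleton]
      omega

/-- By Hall's theorem, a pairwise disjoint subfamily `D` and a maximum pairwise disjoint
subfamily `C` can be pierced together by as few points as `C` alone. -/
lemma PierceableOn.union_of_max [DecidableEq ι] (hne : ∀ i, (F i).Nonempty) (helly : HellyTwo F)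
    {S C D : Finset ι} (hCS : C ⊆ S) (hC : PairwiseDisjOn F C)
    (hmax : ∀ E ⊆ S, PairwiseDisjOn F E → E.card ≤ C.card)
    (hDS : D ⊆ S \ C) (hD : PairwiseDisjOn F D) : PierceableOn F (C ∪ D) C.card := by
  classical
  have hDC : ∀ i ∈ D, i ∉ C := fun i hi => (Finset.mem_sdiff.1 (hDS hi)).2
  let N : D → Finset ι := fun x => C.filter (fun v => (F x ∩ F v).Nonempty)
  have hall : ∀ A : Finset D, A.card ≤ (A.biUnion N).card := by
    intro A
    set A' : Finset ι := A.map (Function.Embedding.subtype _) with hA'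
    have hA'D : A' ⊆ D := by
      intro i hi
      simp only [hA', Finset.mem_map, Function.Embedding.coe_subtype] at hi
      obtain ⟨a, -, rfl⟩ := hi
      exact a.2
    have hcardA : A'.card = A.card := Finset.card_map _
    have hNC : A.biUnion N ⊆ C := Finset.biUnion_subset.2 fun _ _ => Finset.filter_subset _ _
    have hmixed : ∀ i ∈ A', ∀ v ∈ C \ A.biUnion N, ¬ (F i ∩ F v).Nonempty := by
      intro i hi v hv hiv
      simp only [hA', Finset.mem_map, Function.Embedding.coe_subtype] at hi
      obtain ⟨a, ha, rfl⟩ := hi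
      rw [Finset.mem_sdiff] at hv
      exact hv.2 (Finset.mem_biUnion.2 ⟨a, ha, Finset.mem_filter.2 ⟨hv.1, hiv⟩⟩)
    have hdisj : PairwiseDisjOn F (A' ∪ (C \ A.biUnion N)) := by
      intro i hi j hj hij
      rcases Finset.mem_union.1 hi with hi | hi <;> rcases Finset.mem_union.1 hj with hj | hj
      · exact hD i (hA'D hi) j (hA'D hj) hij
      · exact hmixed i hi j hj
      · rw [Set.inter_comm]
        exact hmixed j hj i hi
      · exact hC i (Finset.mem_sdiff.1 hi).1 j (Finset.mem_sdiff.1 hj).1 hij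
    have hle := hmax _ (Finset.union_subset (hA'D.trans (hDS.trans Finset.sdiff_subset))
      (Finset.sdiff_subset.trans hCS)) hdisj
    rw [Finset.card_union_of_disjoint] at hle
    · have := Finset.card_sdiff_add_card_eq_card hNC
      omega
    · rw [Finset.disjoint_left]
      exact fun i hi hi' => hDC i (hA'D hi) (Finset.mem_sdiff.1 hi').1
  obtain ⟨φ, hφinj, hφ⟩ := (Finset.all_card_le_biUnion_card_iff_exists_injective N).1 hall
  have hφC : ∀ x, φ x ∈ C := fun x => (Finset.mem_filter.1 (hφ x)).1
  have hφF : ∀ x : D, (F x ∩ F (φ x)).Nonempty := fun x => (Finset.mem_filter.1 (hφ x)).2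
  have self : ∀ i, (F i ∩ F i).Nonempty := fun i => by simpa using hne i
  refine PierceableOn.of_coloring helly (fun i => if h : i ∈ D then φ ⟨i, h⟩ else i) ?_ ?_
  · intro i hi
    by_cases h : i ∈ D
    · simpa [h] using hφC ⟨i, h⟩
    · simpa [h] using hi
  · intro i _ j _ hij
    by_cases h : i ∈ D <;> by_cases h' : j ∈ D
    · simp only [h, h', dite_true] at hij
      have := congrArg Subtype.val (hφinj hij)
      simp only at this
      rw [this]
      exact self j
    · simp only [h, h', dite_true, dite_false] at hij
      rw [← hij]
      exact hφF ⟨i, h⟩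
    · simp only [h, h', dite_true, dite_false] at hij
      rw [hij, Set.inter_comm]
      exact hφF ⟨j, h'⟩
    · simp only [h, h', dite_false] at hij
      rw [hij]
      exact self j

/-- If the members outside a maximum pairwise disjoint subfamily `C` pairwise intersect, then
`C.card` points pierce everything. -/
lemma PierceableOn.of_split [DecidableEq ι] (hne : ∀ i, (F i).Nonempty) (helly : HellyTwo F)
    {S C : Finset ι} (hCS : C ⊆ S) (hC : PairwiseDisjOn F C)
    (hmax : ∀ E ⊆ S, PairwiseDisjOn F E → E.card ≤ C.card)
    (hrest : ∀ E ⊆ S \ C, PairwiseDisjOn F E → E.card ≤ 1) : PierceableOn F S C.card := by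
  classical
  have hnb : ∀ i ∈ S \ C, ∃ v ∈ C, (F i ∩ F v).Nonempty := by
    intro i hi
    by_contra! hcon
    rw [Finset.mem_sdiff] at hi
    have hd : PairwiseDisjOn F (insert i C) := by
      intro a ha b hb hab
      rw [Finset.mem_insert] at ha hb
      rcases ha with rfl | ha <;> rcases hb with rfl | hb
      · exact absurd rfl hab
      · rw [hcon b hb]; exact Set.not_nonempty_empty
      · rw [Set.inter_comm, hcon a ha]; exact Set.not_nonempty_empty
      · exact hC a ha b hb hab
    have := hmax _ (Finset.insert_subset hi.1 hCS) hd
    rw [Finset.card_insert_of_notMem hi.2] at this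
    omega
  have hpair : ∀ i ∈ S \ C, ∀ j ∈ S \ C, (F i ∩ F j).Nonempty := by
    intro i hi j hj
    by_cases hij : i = j
    · subst hij
      simpa using hne i
    by_contra hcon
    have hd : PairwiseDisjOn F {i, j} := by
      have hcon' : ¬ (F j ∩ F i).Nonempty := by rwa [Set.inter_comm]
      intro a ha b hb hab
      rw [Finset.mem_insert, Finset.mem_singleton] at ha hb
      rcases ha with rfl | rfl <;> rcases hb with rfl | rfl
      · exact absurd rfl hab
      · exact hcon
      · exact hcon'
      · exact absurd rfl hab
    have := hrest {i, j} (by simp [Finset.insert_subset_iff, hi, hj]) hd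
    rw [Finset.card_pair hij] at this
    omega
  choose! v hvC hvF using hnb
  have hout : ∀ i ∈ S, i ∉ C → i ∈ S \ C := fun i hi h => Finset.mem_sdiff.2 ⟨hi, h⟩
  refine PierceableOn.of_coloring helly (fun i => if i ∈ C then i else v i) ?_ ?_
  · intro i hi
    by_cases h : i ∈ C
    · simp [h]
    · simpa [h] using hvC i (hout i hi h)
  · intro i hi j hj hij
    by_cases h : i ∈ C <;> by_cases h' : j ∈ C
    · simp only [h, h', if_true] at hij
      subst hij
      simpa using hne i
    · simp only [h, h', if_true, if_false] at hij
      rw [hij, Set.inter_comm]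
      exact hvF j (hout j hj h')
    · simp only [h, h', if_true, if_false] at hij
      rw [← hij]
      exact hvF i (hout i hi h)
    · exact hpair i (hout i hi h) j (hout j hj h')

lemma HasShallow.sdiff_union [DecidableEq ι] {S U : Finset ι} {m n k t : ℕ} (hUS : U ⊆ S)
    (hU : DepthLE F U t) (htk : t ≤ k) (hm : m + t ≤ n + U.card)
    (h : HasShallow F (S \ U) n (k - t)) : HasShallow F S m k := by
  obtain ⟨V, hVS, s, hs, hcard, hV⟩ := h
  refine ⟨U ∪ V, Finset.union_subset hUS (hVS.trans Finset.sdiff_subset), t + s, by omega, ?_,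
    hU.union hV⟩
  rw [Finset.card_union_of_disjoint]
  · omega
  · rw [Finset.disjoint_right]
    exact fun i hi => (Finset.mem_sdiff.1 (hVS hi)).2

/-- Removing the two largest members of a greedy decomposition into pairwise disjoint subfamilies
reduces the search for a shallow subfamily to a smaller one. -/
lemma HasShallow.of_max_pair [DecidableEq ι] (hne : ∀ i, (F i).Nonempty) (helly : HellyTwo F)
    {S C : Finset ι} {m k : ℕ} (hCS : C ⊆ S) (hC : PairwiseDisjOn F C)
    (hmax : ∀ E ⊆ S, PairwiseDisjOn F E → E.card ≤ C.card)
    (hS : ¬ PierceableOn F S m) (hk : 1 ≤ k) (hkm : 2 ≤ k ∨ m ≤ 1)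
    (ih : ∀ T n, ¬ PierceableOn F T n → 1 ≤ n → n + 2 ≤ m → n + C.card ≤ m →
      HasShallow F T n (k - 2)) : HasShallow F S m k := by
  by_cases hcm : m + 1 ≤ C.card
  · exact ⟨C, hCS, 1, hk, hcm, hC.depthLE⟩
  obtain ⟨D, hDS, hD, hDmax⟩ := exists_max_pairwiseDisjOn F (S \ C)
  by_cases hd : D.card ≤ 1
  · exact absurd ((PierceableOn.of_split hne helly hCS hC hmax
      fun E hE hEd => (hDmax E hE hEd).trans hd).mono subset_rfl (by omega)) hS
  have hDC : D.card ≤ C.card := hmax D (hDS.trans Finset.sdiff_subset) hD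
  have hsub : C ∪ D ⊆ S := Finset.union_subset hCS (hDS.trans Finset.sdiff_subset)
  have hcard : (C ∪ D).card = C.card + D.card := by
    refine Finset.card_union_of_disjoint (Finset.disjoint_right.2 fun i hi => ?_)
    exact (Finset.mem_sdiff.1 (hDS hi)).2
  have hdepth : DepthLE F (C ∪ D) 2 := hC.depthLE.union hD.depthLE
  have hrest : ¬ PierceableOn F (S \ (C ∪ D)) (m + 2 - (C.card + D.card)) := by
    intro h
    have h := (PierceableOn.union_of_max hne helly hCS hC hmax hDS hD).union h
    rw [Finset.union_sdiff_of_subset hsub] at h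
    exact hS (h.mono subset_rfl (by omega))
  refine HasShallow.sdiff_union (n := m + 2 - (C.card + D.card)) hsub hdepth (by omega)
    (by omega) ?_
  rcases Nat.eq_zero_or_pos (m + 2 - (C.card + D.card)) with h0 | h0
  · rw [h0]
    exact HasShallow.zero _ _
  · exact ih _ _ hrest h0 (by omega) (by omega)

lemma exists_pairwiseDisjOn_of_not_pierceableOn (hne : ∀ i, (F i).Nonempty) {f : ℝ → ℝ}
    {S : Finset ι} {s n : ℕ} (hf : 1 ≤ f s)
    (h : HasPQOn F S s 2 → ∃ P : Finset α, (P.card : ℝ) ≤ (s : ℝ) * f s ∧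
      ∀ i ∈ S, ∃ x ∈ P, x ∈ F i)
    (hn : (s : ℝ) * f s ≤ n) (hS : ¬ PierceableOn F S n) :
    ∃ J ⊆ S, J.card = s ∧ PairwiseDisjOn F J := by
  classical
  by_contra! hcon
  apply hS
  have hsn : s ≤ n := by
    have : (s : ℝ) ≤ n := (le_mul_of_one_le_right (Nat.cast_nonneg s) hf).trans hn
    exact_mod_cast this
  by_cases hcard : S.card < s
  · exact (pierceableOn_card hne S).mono subset_rfl (by omega)
  have hpq : HasPQOn F S s 2 := by
    refine ⟨not_lt.1 hcard, fun J hJS hJ => ?_⟩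
    have := hcon J hJS hJ
    simp only [PairwiseDisjOn, not_forall, not_not] at this
    obtain ⟨i, hi, j, hj, hij, hinter⟩ := this
    refine ⟨{i, j}, by simp [Finset.insert_subset_iff, hi, hj], Finset.card_pair hij, ?_⟩
    simpa using hinter
  obtain ⟨P, hP, hPS⟩ := h hpq
  exact ⟨P, by exact_mod_cast hP.trans hn, hPS⟩

/-- If all pairwise disjoint subfamilies are small, disjoint ones of size `s` can be extracted
greedily. -/
lemma HasShallow.of_small_disj [DecidableEq ι] (hne : ∀ i, (F i).Nonempty) (helly : HellyTwo F)
    {S : Finset ι} {m k s c : ℕ}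
    (hmax : ∀ E ⊆ S, PairwiseDisjOn F E → E.card ≤ c) (hS : ¬ PierceableOn F S m)
    (hs : 3 ≤ s) (hcm : 25 * c ≤ m)
    (hsm : m ≤ k * (s - 1))
    (hdisj : ∀ T ⊆ S, ∀ n, ¬ PierceableOn F T n → m ≤ 50 * n →
      ∃ J ⊆ T, J.card = s ∧ PairwiseDisjOn F J) : HasShallow F S m k := by
  by_contra hcon
  obtain ⟨r, rfl⟩ : ∃ r, s = r + 1 := ⟨s - 1, by omega⟩
  rw [Nat.add_sub_cancel] at hsm
  have key : ∀ t ≤ k, ∃ U ⊆ S, U.card = t * (r + 1) ∧ DepthLE F U t := by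
    intro t
    induction t with
    | zero =>
      intro _
      exact ⟨∅, Finset.empty_subset _, by simp, by simpa using depthLE_card (F := F) ∅⟩
    | succ t ih =>
      intro ht
      obtain ⟨U, hUS, hU, hdepth⟩ := ih (by omega)
      have htr : t * r < m := by
        by_contra! h
        exact hcon ⟨U, hUS, t, by omega, by rw [hU]; nlinarith, hdepth⟩
      have hcardU : 2 * U.card ≤ 3 * m := by rw [hU]; nlinarith
      have hrest : ¬ PierceableOn F (S \ U) (m - (U.card + c) / 2) := by
        intro h
        have h := (PierceableOn.half_card hne helly U fun E hE => hmax E (hE.trans hUS)).union h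
        rw [Finset.union_sdiff_of_subset hUS] at h
        exact hS (h.mono subset_rfl (by omega))
      obtain ⟨J, hJ, hJcard, hJd⟩ := hdisj _ Finset.sdiff_subset _ hrest (by omega)
      refine ⟨U ∪ J, Finset.union_subset hUS (hJ.trans Finset.sdiff_subset), ?_,
        hdepth.union hJd.depthLE⟩
      rw [Finset.card_union_of_disjoint, hU, hJcard]
      · ring
      · exact Finset.disjoint_right.2 fun i hi => (Finset.mem_sdiff.1 (hJ hi)).2
  obtain ⟨U, hUS, hU, hdepth⟩ := key k le_rfl
  exact hcon ⟨U, hUS, k, le_rfl, by rw [hU]; nlinarith, hdepth⟩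

lemma add_one_sub_div_le_of_deriv_ge {f f' : ℝ → ℝ} (hderiv : ∀ x : ℝ, 2 ≤ x → HasDerivAt f (f' x) x)
    (hlb : ∀ x : ℝ, 2 ≤ x → 1 / (x * Real.log 2) ≤ f' x) {x y : ℝ} (hx : 2 ≤ x) (hxy : x ≤ y) :
    f x + (1 - x / y) ≤ f y := by
  have hmono : MonotoneOn (fun z => f z - Real.log z) (Set.Ici 2) := by
    have hd : ∀ z : ℝ, 2 ≤ z → HasDerivAt (fun z => f z - Real.log z) (f' z - z⁻¹) z :=
      fun z hz => (hderiv z hz).sub (Real.hasDerivAt_log (by linarith))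
    refine monotoneOn_of_deriv_nonneg (convex_Ici 2)
      (fun z hz => (hd z hz).continuousAt.continuousWithinAt) ?_ ?_
    · rw [interior_Ici]
      exact fun z hz => (hd z (le_of_lt hz)).differentiableAt.differentiableWithinAt
    · rw [interior_Ici]
      intro z hz
      have hz : (2 : ℝ) < z := hz
      rw [(hd z hz.le).deriv]
      have h1 := hlb z hz.le
      have hlog : Real.log 2 ≤ 1 := by linarith [Real.log_two_lt_d9]
      have hpos : 0 < Real.log 2 := Real.log_pos (by norm_num)
      have h2 : z⁻¹ ≤ 1 / (z * Real.log 2) := by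
        rw [← one_div]
        exact one_div_le_one_div_of_le (by positivity) (by nlinarith)
      linarith
  have h := hmono (Set.mem_Ici.2 hx) (Set.mem_Ici.2 (hx.trans hxy)) hxy
  have hx0 : 0 < x := by linarith
  have hy0 : 0 < y := by linarith
  have hlog := Real.one_sub_inv_le_log_of_pos (div_pos hy0 hx0)
  rw [inv_div, Real.log_div hy0.ne' hx0.ne'] at hlog
  simp only at h
  linarith

/-- A family that cannot be pierced by `m` points has a shallow subfamily. -/
theorem hasShallow_of_not_pierceableOn [DecidableEq ι] (hne : ∀ i, (F i).Nonempty)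
    (helly : HellyTwo F) {f f' : ℝ → ℝ} (hrange : ∀ x : ℝ, 2 ≤ x → 1 ≤ f x)
    (hderiv : ∀ x : ℝ, 2 ≤ x → HasDerivAt f (f' x) x)
    (hlb : ∀ x : ℝ, 2 ≤ x → 1 / (x * Real.log 2) ≤ f' x)
    (hp2 : ∀ p : ℕ, 2 ≤ p → ∀ S : Finset ι, HasPQOn F S p 2 →
      ∃ P : Finset α, (P.card : ℝ) ≤ (p : ℝ) * f p ∧ ∀ i ∈ S, ∃ x ∈ P, x ∈ F i)
    (m : ℕ) : ∀ (S : Finset ι) (k : ℕ), 1 ≤ m → ¬ PierceableOn F S m →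
      (m ≤ k ∨ 200 * f (2 * ((m : ℝ) + k) / (k + 1)) ≤ k + 1) → HasShallow F S m k := by
  induction m using Nat.strong_induction_on with
  | _ m ih =>
  intro S k hm hS hk
  obtain ⟨C, hCS, hC, hmax⟩ := exists_max_pairwiseDisjOn F S
  by_cases hmk : m ≤ k
  · refine HasShallow.of_max_pair hne helly hCS hC hmax hS (by omega) (by omega) ?_
    intro T n hT hn hnm _
    exact ih n (by omega) T (k - 2) hn hT (Or.inl (by omega))
  have hk := hk.resolve_left hmk
  push Not at hmk
  have hmk' : (k : ℝ) + 1 ≤ m := by exact_mod_cast hmk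
  have hq : (0 : ℝ) < (k : ℝ) + 1 := by positivity
  have hx2 : 2 ≤ 2 * ((m : ℝ) + k) / (k + 1) := by
    rw [le_div_iff₀ hq]
    have : (0 : ℝ) ≤ k := Nat.cast_nonneg k
    linarith
  have hk199 : 199 ≤ k := by
    have : (199 : ℝ) ≤ k := by linarith [hrange _ hx2]
    exact_mod_cast this
  have hk199' : (199 : ℝ) ≤ k := by exact_mod_cast hk199
  by_cases hc : m + k ≤ 50 * C.card
  · refine HasShallow.of_max_pair hne helly hCS hC hmax hS (by omega) (by omega) ?_
    intro T n hT hn hnm hnC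
    refine ih n (by omega) T (k - 2) hn hT (Or.inr ?_)
    have hcast : ((k - 2 : ℕ) : ℝ) = k - 2 := by
      rw [Nat.cast_sub (by omega)]; norm_num
    have hn' : (1 : ℝ) ≤ n := by exact_mod_cast hn
    have hbound : 50 * (n : ℝ) ≤ 49 * m - k := by
      have : 50 * n + k ≤ 49 * m := by omega
      have : 50 * (n : ℝ) + k ≤ 49 * m := by exact_mod_cast this
      linarith
    rw [hcast]
    have hq' : (0 : ℝ) < (k : ℝ) - 2 + 1 := by linarith
    set x : ℝ := 2 * ((n : ℝ) + (k - 2)) / (k - 2 + 1) with hx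
    set y : ℝ := 2 * ((m : ℝ) + k) / (k + 1) with hy
    have hx2' : 2 ≤ x := by
      rw [hx, le_div_iff₀ hq']
      linarith
    have hxy : x ≤ 99 / 100 * y := by
      rw [hx, hy, ← mul_div_assoc, div_le_div_iff₀ hq' hq]
      have hnm' : (n : ℝ) + (k - 2) ≤ 49 / 50 * ((m : ℝ) + k) := by linarith
      have hq2 : ((k : ℝ) + 1) * (49 / 50) ≤ 99 / 100 * (k - 2 + 1) := by linarith
      nlinarith [mul_le_mul_of_nonneg_left hq2 (by positivity : (0 : ℝ) ≤ (m : ℝ) + k),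
        mul_le_mul_of_nonneg_right hnm' hq.le]
    have hy0 : 0 < y := by linarith
    have h := add_one_sub_div_le_of_deriv_ge hderiv hlb hx2' (show x ≤ y by linarith)
    have : x / y ≤ 99 / 100 := by rwa [div_le_iff₀ hy0]
    linarith
  · set s : ℕ := 2 * (m + k) / (k + 1) with hs
    have hs_le : (s : ℝ) ≤ 2 * ((m : ℝ) + k) / (k + 1) := by
      rw [le_div_iff₀ hq]
      have : s * (k + 1) ≤ 2 * (m + k) := Nat.div_mul_le_self _ _
      exact_mod_cast this
    have hs3 : 3 ≤ s := by
      rw [hs, Nat.le_div_iff_mul_le (by omega)]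
      omega
    have hs2 : (2 : ℝ) ≤ s := by exact_mod_cast (show 2 ≤ s by omega)
    have hfs : f s ≤ (k + 1) / 200 := by
      have h := add_one_sub_div_le_of_deriv_ge hderiv hlb hs2 hs_le
      have : (s : ℝ) / (2 * ((m : ℝ) + k) / (k + 1)) ≤ 1 :=
        div_le_one_of_le₀ hs_le (by linarith)
      linarith
    have hsf : (s : ℝ) * f s ≤ ((m : ℝ) + k) / 100 := by
      calc (s : ℝ) * f s ≤ 2 * ((m : ℝ) + k) / (k + 1) * ((k + 1) / 200) :=
            mul_le_mul hs_le hfs (by linarith [hrange _ hs2]) (by linarith)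
        _ = ((m : ℝ) + k) / 100 := by field_simp; norm_num
    refine HasShallow.of_small_disj (s := s) hne helly hmax hS hs3 (by omega) ?_ ?_
    · have hlt : 2 * (m + k) < (s + 1) * (k + 1) := by
        rw [hs]
        exact Nat.lt_mul_of_div_lt (Nat.lt_succ_self _) (Nat.succ_pos k)
      have hub : s * (k + 1) ≤ 2 * (m + k) := Nat.div_mul_le_self _ _
      obtain ⟨r, hr⟩ : ∃ r, s = r + 1 := ⟨s - 1, by omega⟩
      rw [hr] at hlt hub ⊢
      rw [Nat.add_sub_cancel]
      have : 4 * (r + 1) ≤ 2 * m := by nlinarith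
      nlinarith
    · intro T _ n hT hmn
      refine exists_pairwiseDisjOn_of_not_pierceableOn hne (hrange _ hs2)
        (hp2 s (by omega) T) ?_ hT
      have : ((m : ℝ) + k) ≤ 100 * n := by exact_mod_cast (show m + k ≤ 100 * n by omega)
      linarith

lemma HasPQ.not_hasShallow [Fintype ι] {p q : ℕ} (hpq : HasPQ F p q) (hq : 1 ≤ q) (hqp : q ≤ p)
    (S : Finset ι) : ¬ HasShallow F S (p - q + 1) (q - 1) := by
  classical
  rintro ⟨U, -, t, ht, hcard, hU⟩
  obtain ⟨J, hJ, hJd⟩ : ∃ J : Finset ι, J.card = p ∧ DepthLE F J (q - 1) := by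
    by_cases hUp : p ≤ U.card
    · obtain ⟨J, hJU, hJ⟩ := Finset.exists_subset_card_eq hUp
      exact ⟨J, hJ, hU.mono hJU ht⟩
    · obtain ⟨J, hUJ, -, hJ⟩ := Finset.exists_subsuperset_card_eq (Finset.subset_univ U)
        (le_of_not_ge hUp) (by simpa using hpq.1)
      refine ⟨J, hJ, ?_⟩
      have h := hU.union (depthLE_card (F := F) (J \ U))
      rw [Finset.union_sdiff_of_subset hUJ] at h
      have := Finset.card_sdiff_add_card_eq_card hUJ
      exact h.mono subset_rfl (by omega)
  obtain ⟨K, hKJ, hK, hne⟩ := hpq.2 J hJ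
  have := hJd K hKJ hne
  omega

end Piercing

/-- Theorem 1.4 (main theorem): for a family in `ℝ^d` with Helly number 2, a
`(p,2)`-theorem with piercing number `p·f(p)` implies the tight `(p,q)`-theorem
`HD(p,q) = p - q + 1` for all `q ≥ T₁₀₀(p)`, where
`T_c(p) = min {q : q ≥ 2c·f(2p/q)}`. The condition `q ≥ T₁₀₀(p)` is rendered as
the existence of an integer `2 ≤ q₀ ≤ min(p, q)` with `q₀ ≥ 200·f(2p/q₀)`. -/
theorem main_pq_from_p2 (d : ℕ) (hd : 1 ≤ d) {ι : Type} [Fintype ι]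
    (F : ι → Set (Fin d → ℝ))
    (hne : ∀ i, (F i).Nonempty)
    (helly : ∀ S : Finset ι,
      (∀ i ∈ S, ∀ j ∈ S, (F i ∩ F j).Nonempty) → (⋂ i ∈ S, F i).Nonempty)
    (f f' : ℝ → ℝ)
    (hrange : ∀ x : ℝ, 2 ≤ x → 1 ≤ f x)
    (hderiv : ∀ x : ℝ, 2 ≤ x → HasDerivAt f (f' x) x)
    (hf'lb : ∀ x : ℝ, 2 ≤ x → 1 / (x * Real.log 2) ≤ f' x)
    (hf'ub : ∀ x : ℝ, 2 ≤ x → f' x / f x ≤ 5 / x)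
    (hp2 : ∀ p : ℕ, 2 ≤ p → ∀ S : Finset ι, HasPQOn F S p 2 →
      ∃ P : Finset (Fin d → ℝ), (P.card : ℝ) ≤ (p : ℝ) * f p ∧
        ∀ i ∈ S, ∃ x ∈ P, x ∈ F i)
    (p q : ℕ) (hq2 : 2 ≤ q) (hqp : q ≤ p)
    (hT : ∃ q₀ : ℕ, 2 ≤ q₀ ∧ (q₀ : ℝ) ≤ (p : ℝ) ∧
      200 * f (2 * (p : ℝ) / (q₀ : ℝ)) ≤ (q₀ : ℝ) ∧ q₀ ≤ q)
    (hpq : HasPQ F p q) :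
    ∃ P : Finset (Fin d → ℝ), P.card ≤ p - q + 1 ∧ Pierces F P := by
  classical
  by_contra hcon
  have hnot : ¬ PierceableOn F Finset.univ (p - q + 1) := by
    rintro ⟨P, hP, h⟩
    exact hcon ⟨P, hP, fun i => h i (Finset.mem_univ i)⟩
  refine hpq.not_hasShallow (by omega) hqp Finset.univ ?_
  refine hasShallow_of_not_pierceableOn hne helly hrange hderiv hf'lb hp2 _ _ _ (by omega) hnot
    (Or.inr ?_)
  obtain ⟨q₀, hq₀, -, hfq₀, hq₀q⟩ := hT
  have h1 : ((p - q + 1 : ℕ) : ℝ) + ((q - 1 : ℕ) : ℝ) = p := by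
    exact_mod_cast (show p - q + 1 + (q - 1) = p by omega)
  have h2 : ((q - 1 : ℕ) : ℝ) + 1 = q := by
    exact_mod_cast (show q - 1 + 1 = q by omega)
  rw [h1, h2]
  have hq₀0 : (0 : ℝ) < q₀ := by exact_mod_cast (show 0 < q₀ by omega)
  have hq₀q' : (q₀ : ℝ) ≤ q := by exact_mod_cast hq₀q
  have hqp' : (q : ℝ) ≤ p := by exact_mod_cast hqp
  have hx : 2 ≤ 2 * (p : ℝ) / q := by
    rw [le_div_iff₀ (by linarith)]
    linarith
  have hxy : 2 * (p : ℝ) / q ≤ 2 * (p : ℝ) / q₀ :=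
    div_le_div_of_nonneg_left (by positivity) hq₀0 hq₀q'
  have h := add_one_sub_div_le_of_deriv_ge hderiv hf'lb hx hxy
  have : 2 * (p : ℝ) / q / (2 * (p : ℝ) / q₀) ≤ 1 := div_le_one_of_le₀ hxy (by linarith)
  linarith
end

section
/- There exists a universal constant c > 0 such that for every dimension d ≥ 1 and all integers p ≥ q ≥ 2 with q > c·(log₂ p)^{d−1}, every finite indexed family of axis-parallel boxes in ℝ^d satisfying the (p,q)-property can be pierced by at most p − q + 1 points. -/
/-- An axis-parallel box in `ℝ^d`: a nonempty product of closed bounded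
intervals, i.e. `Set.Icc a b` in `Fin d → ℝ` with `a ≤ b`. -/
def IsBox {d : ℕ} (A : Set (Fin d → ℝ)) : Prop :=
  ∃ a b : Fin d → ℝ, a ≤ b ∧ A = Set.Icc a b

namespace BoxPiercing

open Finset

variable {ι : Type*} {d : ℕ}

/-- The boxes `[a i, b i]` and `[a j, b j]` intersect (for nonempty boxes). -/
def Meets (a b : ι → Fin d → ℝ) (i j : ι) : Prop := a i ≤ b j ∧ a j ≤ b i

/-- Any two boxes with indices in `K` intersect. -/
def IsCliq (a b : ι → Fin d → ℝ) (K : Finset ι) : Prop := ∀ i ∈ K, ∀ j ∈ K, Meets a b i j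

/-- Distinct boxes with indices in `S` are disjoint. -/
def IsPacking (a b : ι → Fin d → ℝ) (S : Finset ι) : Prop :=
  ∀ i ∈ S, ∀ j ∈ S, i ≠ j → ¬ Meets a b i j

/-- The boxes with indices in `S` can be pierced by at most `n` points. -/
def PiercedBy (a b : ι → Fin d → ℝ) (S : Finset ι) (n : ℕ) : Prop :=
  ∃ P : Finset (Fin d → ℝ), P.card ≤ n ∧ ∀ i ∈ S, ∃ x ∈ P, a i ≤ x ∧ x ≤ b i

open Classical in
/-- The maximal number of pairwise disjoint boxes with indices in `S`. -/
noncomputable def packingNumber (a b : ι → Fin d → ℝ) (S : Finset ι) : ℕ :=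
  (S.powerset.filter (IsPacking a b)).sup card

variable {a b : ι → Fin d → ℝ}

lemma Meets.symm {i j : ι} (h : Meets a b i j) : Meets a b j i := ⟨h.2, h.1⟩

lemma IsPacking.card_le {S D : Finset ι} (hD : IsPacking a b D) (h : D ⊆ S) :
    D.card ≤ packingNumber a b S := by
  classical
  unfold packingNumber
  exact Finset.le_sup (f := card) (by simp [h, hD])

lemma exists_isPacking (a b : ι → Fin d → ℝ) (S : Finset ι) :
    ∃ D ⊆ S, IsPacking a b D ∧ D.card = packingNumber a b S := by
  classical
  unfold packingNumber
  obtain ⟨D, hD, h⟩ := Finset.exists_mem_eq_sup (S.powerset.filter (IsPacking a b))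
    ⟨∅, by simp [IsPacking]⟩ card
  simp only [mem_filter, mem_powerset] at hD
  exact ⟨D, hD.1, hD.2, h.symm⟩

lemma packingNumber_mono {S T : Finset ι} (h : S ⊆ T) :
    packingNumber a b S ≤ packingNumber a b T := by
  obtain ⟨D, hD, hp, hc⟩ := exists_isPacking a b S
  rw [← hc]
  exact hp.card_le (hD.trans h)

lemma PiercedBy.mono {S T : Finset ι} {m n : ℕ} (h : PiercedBy a b T n) (hS : S ⊆ T)
    (hn : n ≤ m) : PiercedBy a b S m := by
  obtain ⟨P, hP, h⟩ := h
  exact ⟨P, hP.trans hn, fun i hi => h i (hS hi)⟩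

lemma PiercedBy.union [DecidableEq ι] {S T : Finset ι} {m n : ℕ} (hS : PiercedBy a b S m)
    (hT : PiercedBy a b T n) : PiercedBy a b (S ∪ T) (m + n) := by
  classical
  obtain ⟨P, hP, hS⟩ := hS
  obtain ⟨Q, hQ, hT⟩ := hT
  refine ⟨P ∪ Q, (card_union_le _ _).trans (by lia), fun i hi => ?_⟩
  rcases mem_union.1 hi with hi | hi
  · obtain ⟨x, hx, h⟩ := hS i hi
    exact ⟨x, mem_union_left _ hx, h⟩
  · obtain ⟨x, hx, h⟩ := hT i hi
    exact ⟨x, mem_union_right _ hx, h⟩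

/-- Boxes have Helly number two. -/
lemma IsCliq.piercedBy {K : Finset ι} (hK : IsCliq a b K) : PiercedBy a b K 1 := by
  rcases K.eq_empty_or_nonempty with rfl | hne
  · exact ⟨∅, by simp, by simp⟩
  · refine ⟨{K.sup' hne a}, by simp, fun i hi => ⟨_, mem_singleton_self _, ?_, ?_⟩⟩
    · exact Finset.le_sup' a hi
    · exact Finset.sup'_le hne a fun j hj => (hK j hj i hi).1

lemma piercedBy_card (hab : ∀ i, a i ≤ b i) (S : Finset ι) : PiercedBy a b S S.card := by
  classical
  exact ⟨S.image a, card_image_le, fun i hi => ⟨a i, mem_image_of_mem _ hi, le_rfl, hab i⟩⟩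

lemma IsCliq.card_inter_le_one [DecidableEq ι] {K S : Finset ι} (hK : IsCliq a b K)
    (hS : IsPacking a b S) : (K ∩ S).card ≤ 1 := by
  refine Finset.card_le_one.2 fun x hx y hy => ?_
  rw [mem_inter] at hx hy
  by_contra hne
  exact hS x hx.2 y hy.2 hne (hK x hx.1 y hy.1)

/-- Pairing up intersecting boxes greedily saves one point per pair. -/
lemma exists_pairing [DecidableEq ι] (hab : ∀ i, a i ≤ b i) (S : Finset ι) :
    ∃ N ⊆ S, IsPacking a b N ∧ ∃ m, S.card = 2 * m + N.card ∧
      PiercedBy a b S (m + N.card) := by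
  induction S using Finset.strongInduction with
  | H S ih =>
    by_cases hS : IsPacking a b S
    · exact ⟨S, Subset.rfl, hS, 0, by simp, by simpa using piercedBy_card hab S⟩
    · unfold IsPacking at hS
      push Not at hS
      obtain ⟨x, hx, y, hy, hne, hxy⟩ := hS
      have hsub : ({x, y} : Finset ι) ⊆ S := by
        intro z hz
        simp only [mem_insert, mem_singleton] at hz
        rcases hz with rfl | rfl <;> assumption
      obtain ⟨N, hN, hp, m, hc, hP⟩ := ih (S \ {x, y})
        (Finset.sdiff_ssubset hsub ⟨x, by simp⟩)
      refine ⟨N, hN.trans sdiff_subset, hp, m + 1, ?_, ?_⟩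
      · have := card_sdiff_add_card_eq_card hsub
        rw [card_pair hne] at this
        lia
      · have hcl : IsCliq a b {x, y} := by
          intro i hi j hj
          simp only [mem_insert, mem_singleton] at hi hj
          rcases hi with rfl | rfl <;> rcases hj with rfl | rfl
          · exact ⟨hab _, hab _⟩
          · exact hxy
          · exact hxy.symm
          · exact ⟨hab _, hab _⟩
        have := hP.union hcl.piercedBy
        rw [sdiff_union_of_subset hsub] at this
        exact this.mono Subset.rfl (by lia)

/-- At most `2 * d` members of a finite family of boxes decide which boxes meet all members. -/
lemma exists_extremal [DecidableEq ι] (a b : ι → Fin d → ℝ) (K : Finset ι) :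
    ∃ K₀ ⊆ K, K₀.card ≤ 2 * d ∧
      ∀ v, (∀ w ∈ K₀, Meets a b v w) → ∀ w ∈ K, Meets a b v w := by
  rcases K.eq_empty_or_nonempty with rfl | hne
  · exact ⟨∅, by simp, by simp, by simp⟩
  · choose f hfK hf using fun s : Fin d => K.exists_max_image (fun i => a i s) hne
    choose g hgK hg using fun s : Fin d => K.exists_min_image (fun i => b i s) hne
    refine ⟨univ.image f ∪ univ.image g, ?_, ?_, fun v hv w hw => ⟨fun s => ?_, fun s => ?_⟩⟩
    · intro x hx
      simp only [mem_union, mem_image, mem_univ, true_and] at hx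
      rcases hx with ⟨s, rfl⟩ | ⟨s, rfl⟩
      · exact hfK s
      · exact hgK s
    · have h₁ : (univ.image f).card ≤ d := by simpa using card_image_le (s := univ) (f := f)
      have h₂ : (univ.image g).card ≤ d := by simpa using card_image_le (s := univ) (f := g)
      exact (card_union_le _ _).trans (by lia)
    · exact ((hv (g s) (by simp)).1 s).trans (hg s w hw)
    · exact (hf s w hw).trans ((hv (f s) (by simp)).2 s)

/-- A subfamily of at most `4 * d` members containing, for every box `v`, all members disjoint
from `v` or at least two of them. -/
lemma exists_kernel [DecidableEq ι] (a b : ι → Fin d → ℝ) (K : Finset ι) :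
    ∃ K' ⊆ K, K'.card ≤ 4 * d ∧ ∀ v, ∀ B ⊆ K', B.card ≤ 1 →
      (∀ w ∈ K' \ B, Meets a b v w) → ∀ w ∈ K \ K', Meets a b v w := by
  obtain ⟨K₀, hK₀, hc₀, h₀⟩ := exists_extremal a b K
  obtain ⟨K₁, hK₁, hc₁, h₁⟩ := exists_extremal a b (K \ K₀)
  refine ⟨K₀ ∪ K₁, union_subset hK₀ (hK₁.trans sdiff_subset),
    (card_union_le _ _).trans (by lia), fun v B _ hB hv w hw => ?_⟩
  simp only [mem_sdiff, mem_union, not_or] at hw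
  by_cases hv₀ : ∀ u ∈ K₀, Meets a b v u
  · exact h₀ v hv₀ w hw.1
  · push Not at hv₀
    obtain ⟨u, hu, hvu⟩ := hv₀
    have huB : u ∈ B := by
      by_contra h
      exact hvu (hv u (by simp [hu, h]))
    refine h₁ v (fun z hz => ?_) w (by simp [hw.1, hw.2.1])
    have hzK := mem_sdiff.1 (hK₁ hz)
    refine hv z (mem_sdiff.2 ⟨mem_union_right _ hz, fun hzB => hzK.2 ?_⟩)
    rwa [← Finset.card_le_one.1 hB u huB z hzB]

/-- A large subfamily of small depth, obtained as a union of maximum packings. -/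
lemma exists_layers [Fintype ι] [DecidableEq ι] (a b : ι → Fin d → ℝ) (j : ℕ) :
    ∃ M : Finset ι, (∀ K ⊆ M, IsCliq a b K → K.card ≤ j + 1) ∧
      packingNumber a b univ + j * packingNumber a b (univ \ M) ≤ M.card := by
  induction j with
  | zero =>
    obtain ⟨D, _, hp, hc⟩ := exists_isPacking a b univ
    refine ⟨D, fun K hK hcl => ?_, by simp [hc]⟩
    simpa [inter_eq_left.2 hK] using hcl.card_inter_le_one hp
  | succ j ih =>
    obtain ⟨M, hM, hc⟩ := ih
    obtain ⟨D, hD, hp, hDc⟩ := exists_isPacking a b (univ \ M)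
    refine ⟨M ∪ D, fun K hK hcl => ?_, ?_⟩
    · have h₁ := hM (K ∩ M) inter_subset_right
        (fun x hx y hy => hcl x (mem_inter.1 hx).1 y (mem_inter.1 hy).1)
      have h₂ := hcl.card_inter_le_one hp
      have h₃ : K = (K ∩ M) ∪ (K ∩ D) := by
        rw [← inter_union_distrib_left, inter_eq_left.2 hK]
      have h₄ := card_union_le (K ∩ M) (K ∩ D)
      rw [← h₃] at h₄
      lia
    · have hdis : Disjoint M D := by
        rw [disjoint_right]
        exact fun x hx => (mem_sdiff.1 (hD hx)).2
      rw [card_union_of_disjoint hdis, hDc]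
      have hmono : packingNumber a b (univ \ (M ∪ D)) ≤ packingNumber a b (univ \ M) :=
        packingNumber_mono (sdiff_subset_sdiff Subset.rfl subset_union_left)
      have := Nat.mul_le_mul_left (j + 1) hmono
      lia

lemma piercedBy_one_of_packingNumber_le_one (hab : ∀ i, a i ≤ b i) {S : Finset ι}
    (h : packingNumber a b S ≤ 1) : PiercedBy a b S 1 ∧ IsCliq a b S := by
  classical
  have hcl : IsCliq a b S := by
    intro i hi j hj
    by_contra hij
    have hne : i ≠ j := by
      rintro rfl
      exact hij ⟨hab i, hab i⟩
    have hp : IsPacking a b {i, j} := by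
      intro x hx y hy hxy
      simp only [mem_insert, mem_singleton] at hx hy
      rcases hx with rfl | rfl <;> rcases hy with rfl | rfl
      · exact absurd rfl hxy
      · exact hij
      · exact fun h => hij h.symm
      · exact absurd rfl hxy
    have := hp.card_le (S := S) (by
      intro z hz
      simp only [mem_insert, mem_singleton] at hz
      rcases hz with rfl | rfl <;> assumption)
    rw [card_pair hne] at this
    lia
  exact ⟨hcl.piercedBy, hcl⟩

/-- If the family consists of `D` pairwise disjoint boxes and two cliques, then bounded
subfamilies decide whether all but `D` of the boxes have a common point. -/
lemma piercedBy_of_packing_of_cliques [Fintype ι] [DecidableEq ι] (hab : ∀ i, a i ≤ b i)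
    {D q : ℕ}
    (h : ∀ G : Finset ι, G.card ≤ D + q → ∃ K ⊆ G, IsCliq a b K ∧ G.card ≤ K.card + D)
    (hd : 8 * d ≤ q) {N K E : Finset ι} (hN : IsPacking a b N) (hNc : N.card = D)
    (hK : IsCliq a b K) (hE : IsCliq a b E) (hNK : Disjoint N K) (hNE : Disjoint N E)
    (hKE : Disjoint K E) (hU : N ∪ K ∪ E = univ) : PiercedBy a b univ (D + 1) := by
  obtain ⟨K', hK', hKc, hKk⟩ := exists_kernel a b K
  obtain ⟨E', hE', hEc, hEk⟩ := exists_kernel a b E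
  have hd₁ : Disjoint K' E' := disjoint_of_subset_left hK' (disjoint_of_subset_right hE' hKE)
  have hd₂ : Disjoint N (K' ∪ E') := by
    rw [disjoint_union_right]
    exact ⟨disjoint_of_subset_right hK' hNK, disjoint_of_subset_right hE' hNE⟩
  have hGc : (N ∪ (K' ∪ E')).card = D + (K'.card + E'.card) := by
    rw [card_union_of_disjoint hd₂, card_union_of_disjoint hd₁, hNc]
  obtain ⟨W, hW, hWcl, hWc⟩ := h (N ∪ (K' ∪ E')) (by lia)
  have hWN := hWcl.card_inter_le_one hN
  have hmiss : ((K' ∪ E') \ W).card ≤ 1 := by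
    have h₁ : W.card ≤ (W ∩ N).card + (W ∩ (K' ∪ E')).card := by
      have h₂ := card_union_le (W ∩ N) (W ∩ (K' ∪ E'))
      rwa [← inter_union_distrib_left, inter_eq_left.2 hW] at h₂
    have h₃ := card_sdiff_add_card_inter (K' ∪ E') W
    rw [inter_comm, card_union_of_disjoint hd₁] at h₃
    lia
  have hmK : (K' \ W).card ≤ 1 :=
    (card_le_card (sdiff_subset_sdiff subset_union_left Subset.rfl)).trans hmiss
  have hmE : (E' \ W).card ≤ 1 :=
    (card_le_card (sdiff_subset_sdiff subset_union_right Subset.rfl)).trans hmiss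
  have key : ∀ C C' : Finset ι, (∀ v, ∀ B ⊆ C', B.card ≤ 1 →
      (∀ w ∈ C' \ B, Meets a b v w) → ∀ w ∈ C \ C', Meets a b v w) → (C' \ W).card ≤ 1 →
      ∀ v, (∀ w ∈ W, Meets a b v w) → ∀ w ∈ C \ C', Meets a b v w := by
    intro C C' hC hm v hv w hw
    refine hC v (C' \ W) sdiff_subset hm (fun u hu => hv u ?_) w hw
    simp only [mem_sdiff] at hu
    tauto
  have hWK : ∀ v ∈ W, ∀ w ∈ K \ K', Meets a b v w :=
    fun v hv => key K K' hKk hmK v fun w hw => hWcl v hv w hw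
  have hWE : ∀ v ∈ W, ∀ w ∈ E \ E', Meets a b v w :=
    fun v hv => key E E' hEk hmE v fun w hw => hWcl v hv w hw
  have hKEm : ∀ v ∈ K \ K', ∀ w ∈ E \ E', Meets a b v w :=
    fun v hv => key E E' hEk hmE v fun w hw => (hWK w hw v hv).symm
  have hcl : IsCliq a b (W ∪ (K \ K') ∪ (E \ E')) := by
    intro x hx y hy
    rcases mem_union.1 hx with hx | hx
    · rcases mem_union.1 hx with hx | hx <;> rcases mem_union.1 hy with hy | hy
      · rcases mem_union.1 hy with hy | hy
        · exact hWcl x hx y hy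
        · exact hWK x hx y hy
      · exact hWE x hx y hy
      · rcases mem_union.1 hy with hy | hy
        · exact (hWK y hy x hx).symm
        · exact hK x (mem_sdiff.1 hx).1 y (mem_sdiff.1 hy).1
      · exact hKEm x hx y hy
    · rcases mem_union.1 hy with hy | hy
      · rcases mem_union.1 hy with hy | hy
        · exact (hWE y hy x hx).symm
        · exact (hKEm y hy x hx).symm
      · exact hE x (mem_sdiff.1 hx).1 y (mem_sdiff.1 hy).1
  have hrest : ((N ∪ (K' ∪ E')) \ W).card ≤ D := by
    have := card_sdiff_add_card_eq_card hW
    lia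
  refine ((piercedBy_card hab ((N ∪ (K' ∪ E')) \ W)).union hcl.piercedBy).mono
    (fun x _ => ?_) (by lia)
  have hx : x ∈ N ∪ K ∪ E := by simp [hU]
  simp only [mem_union, mem_sdiff] at hx ⊢
  tauto

/-- A tight piercing bound from a bound on the piercing number by a multiple of the packing
number. -/
lemma piercedBy_of_local [Fintype ι] [DecidableEq ι] (hab : ∀ i, a i ≤ b i) {D q f : ℕ}
    (h : ∀ G : Finset ι, G.card ≤ D + q → ∃ K ⊆ G, IsCliq a b K ∧ G.card ≤ K.card + D)
    (hf : ∀ G : Finset ι, PiercedBy a b G (packingNumber a b G * f))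
    (hq : 4 * f + 2 ≤ q) (hd : 8 * d ≤ q) : PiercedBy a b univ (D + 1) := by
  obtain ⟨M, hM, hMc⟩ := exists_layers a b (4 * f)
  set r := packingNumber a b (univ \ M) with hr
  by_contra hcon
  have hMle : M.card ≤ D + q := by
    by_contra! hlt
    obtain ⟨G, hG, hGc⟩ := exists_subset_card_eq hlt.le
    obtain ⟨K, hK, hcl, hKc⟩ := h G hGc.le
    have := hM K (hK.trans hG) hcl
    lia
  obtain ⟨K, hKM, hK, hKc⟩ := h M hMle
  have hKle := hM K hKM hK
  obtain ⟨N, hN, hNp, m, hm, hP⟩ := exists_pairing hab (M \ K)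
  have hNle := hNp.card_le (subset_univ N)
  have hMK := card_sdiff_add_card_eq_card hKM
  have hpierce : ∀ T, PiercedBy a b (univ \ M) T → D + 1 < m + N.card + 1 + T := by
    intro T hT
    by_contra! hle
    refine hcon (((hP.union hK.piercedBy).union hT).mono (fun x _ => ?_) hle)
    simp only [mem_union, mem_sdiff, mem_univ, true_and]
    tauto
  have hr1 : r ≤ 1 := by
    have hT := hpierce _ (hf (univ \ M))
    rw [← hr] at hT
    by_contra! hr2
    obtain ⟨s, hs⟩ : ∃ s, r = s + 2 := ⟨r - 2, by lia⟩
    rw [hs] at hT hMc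
    nlinarith [Nat.zero_le (s * f)]
  obtain ⟨hE1, hE⟩ := piercedBy_one_of_packingNumber_le_one hab hr1
  have hT := hpierce 1 hE1
  have hm0 : m = 0 := by lia
  have hNeq : N = M \ K := eq_of_subset_of_card_le hN (by lia)
  refine hcon (piercedBy_of_packing_of_cliques hab h hd hNp (by lia) hK hE ?_ ?_ ?_ ?_)
  · rw [hNeq]
    exact sdiff_disjoint
  · exact disjoint_of_subset_left (hN.trans sdiff_subset) disjoint_sdiff
  · exact disjoint_of_subset_left hKM disjoint_sdiff
  · rw [hNeq, sdiff_union_of_subset hKM, union_sdiff_of_subset (subset_univ M)]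

/-- Divide and conquer along one coordinate: boxes meeting a suitable hyperplane have one free
coordinate fewer, and the boxes on either side of it have at most half the packing number. -/
lemma piercedBy_step [DecidableEq ι] (hab : ∀ i, a i ≤ b i) {m : ℕ} (hm : m < d)
    {φ ψ : ℕ → ℕ}
    (hφ : ∀ (S : Finset ι) (y : Fin d → ℝ),
      (∀ i ∈ S, ∀ s : Fin d, m ≤ s → a i s ≤ y s ∧ y s ≤ b i s) →
      ∀ n, packingNumber a b S ≤ n → PiercedBy a b S (φ n))
    (hψ : ∀ n u v, 1 ≤ n → u ≤ n / 2 → v ≤ n / 2 → u + v + 1 ≤ n → ψ u + ψ v + φ n ≤ ψ n)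
    (hmono : Monotone ψ) (n : ℕ) : ∀ (S : Finset ι) (y : Fin d → ℝ),
      (∀ i ∈ S, ∀ s : Fin d, m + 1 ≤ s → a i s ≤ y s ∧ y s ≤ b i s) →
      packingNumber a b S ≤ n → PiercedBy a b S (ψ n) := by
  induction n using Nat.strong_induction_on with
  | _ n ih =>
  intro S y hy hS
  rcases Nat.eq_zero_or_pos n with rfl | hn
  · have hSe : S = ∅ := by
      by_contra hne
      obtain ⟨i, hi⟩ := nonempty_iff_ne_empty.2 hne
      have hp : IsPacking a b {i} := by
        intro x hx z hz hxz
        rw [mem_singleton] at hx hz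
        exact absurd (hx.trans hz.symm) hxz
      have := hp.card_le (singleton_subset_iff.2 hi)
      simp at this
      lia
    subst hSe
    exact ⟨∅, by simp, by simp⟩
  · let s₀ : Fin d := ⟨m, hm⟩
    by_cases hsmall : packingNumber a b S ≤ n / 2
    · exact (ih (n / 2) (by lia) S y hy hsmall).mono Subset.rfl (hmono (by lia))
    · let below : ι → Finset ι := fun i => S.filter fun j => b j s₀ ≤ b i s₀
      have hex : (S.filter fun i => n / 2 < packingNumber a b (below i)).Nonempty := by
        have hSne : S.Nonempty := by
          by_contra hne
          rw [not_nonempty_iff_eq_empty] at hne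
          obtain ⟨D, hD, _, hc⟩ := exists_isPacking a b S
          rw [hne, subset_empty] at hD
          rw [hD] at hc
          simp at hc
          lia
        obtain ⟨i, hi, hmax⟩ := S.exists_max_image (fun i => b i s₀) hSne
        refine ⟨i, mem_filter.2 ⟨hi, ?_⟩⟩
        have : below i = S := filter_true_of_mem hmax
        rw [this]
        lia
      obtain ⟨i, hi, hmin⟩ := exists_min_image _ (fun i => b i s₀) hex
      rw [mem_filter] at hi
      set t := b i s₀ with ht
      let lo := S.filter fun j => b j s₀ < t
      let hi' := S.filter fun j => t < a j s₀
      let mid := S.filter fun j => a j s₀ ≤ t ∧ t ≤ b j s₀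
      have hlo : packingNumber a b lo ≤ n / 2 := by
        rcases lo.eq_empty_or_nonempty with he | hne
        · obtain ⟨D, hD, _, hc⟩ := exists_isPacking a b lo
          rw [he, subset_empty] at hD
          rw [← hc, hD]
          simp
        · obtain ⟨j, hj, hmax⟩ := lo.exists_max_image (fun i => b i s₀) hne
          have hj' := mem_filter.1 hj
          by_contra! hlt
          have hsub : lo ⊆ below j := fun x hx =>
            mem_filter.2 ⟨(mem_filter.1 hx).1, hmax x hx⟩
          have := hmin j (mem_filter.2 ⟨hj'.1, hlt.trans_le (packingNumber_mono hsub)⟩)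
          linarith [hj'.2]
      have hsum : n / 2 + 1 + packingNumber a b hi' ≤ n := by
        obtain ⟨D₁, hD₁, hp₁, hc₁⟩ := exists_isPacking a b (below i)
        obtain ⟨D₂, hD₂, hp₂, hc₂⟩ := exists_isPacking a b hi'
        have hsep : ∀ x ∈ D₁, ∀ z ∈ D₂, ¬ Meets a b x z := by
          intro x hx z hz hxz
          have h₁ := (mem_filter.1 (hD₁ hx)).2
          have h₂ := (mem_filter.1 (hD₂ hz)).2
          have h₃ := hxz.2 s₀
          linarith
        have hdis : Disjoint D₁ D₂ := by
          rw [disjoint_left]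
          exact fun x hx hx' => hsep x hx x hx' ⟨hab x, hab x⟩
        have hp : IsPacking a b (D₁ ∪ D₂) := by
          intro x hx z hz hxz
          rcases mem_union.1 hx with hx | hx <;> rcases mem_union.1 hz with hz | hz
          · exact hp₁ x hx z hz hxz
          · exact hsep x hx z hz
          · exact fun h => hsep z hz x hx h.symm
          · exact hp₂ x hx z hz hxz
        have := hp.card_le (S := S) (union_subset (hD₁.trans (filter_subset _ _))
          (hD₂.trans (filter_subset _ _)))
        rw [card_union_of_disjoint hdis] at this
        lia
      have hPlo := ih (n / 2) (by lia) lo y (fun j hj => hy j (mem_filter.1 hj).1) hlo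
      have hPhi := ih (n - (n / 2 + 1)) (by lia) hi' y
        (fun j hj => hy j (mem_filter.1 hj).1) (by lia)
      have hPmid := hφ mid (Function.update y s₀ t) (fun j hj s hs => by
        by_cases hss : s = s₀
        · subst hss
          simpa using (mem_filter.1 hj).2
        · rw [Function.update_of_ne hss]
          refine hy j (mem_filter.1 hj).1 s ?_
          have : (s : ℕ) ≠ m := fun h => hss (Fin.ext h)
          lia) n ((packingNumber_mono (filter_subset _ _)).trans hS)
      refine ((hPlo.union hPhi).union hPmid).mono (fun x hx => ?_)
        (hψ n _ _ hn le_rfl (by lia) (by lia))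
      simp only [lo, hi', mid, mem_union, mem_filter, hx, true_and]
      by_cases h₁ : b x s₀ < t
      · exact Or.inl (Or.inl h₁)
      · by_cases h₂ : t < a x s₀
        · exact Or.inl (Or.inr h₂)
        · exact Or.inr ⟨not_lt.1 h₂, not_lt.1 h₁⟩

/-- Boxes with `m + 1` free coordinates and packing number at most `n` can be pierced by
`n (1 + log₂ n) ^ m` points. -/
lemma piercedBy_of_free_coordinates [DecidableEq ι] (hab : ∀ i, a i ≤ b i) (m : ℕ)
    (hm : m < d) : ∀ (S : Finset ι) (y : Fin d → ℝ),
      (∀ i ∈ S, ∀ s : Fin d, m + 1 ≤ s → a i s ≤ y s ∧ y s ≤ b i s) →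
      ∀ n, packingNumber a b S ≤ n → PiercedBy a b S (n * (1 + Nat.log 2 n) ^ m) := by
  have hmono : ∀ m, Monotone fun n : ℕ => n * (1 + Nat.log 2 n) ^ m := by
    intro m u v huv
    have := Nat.log_mono_right (b := 2) huv
    dsimp only
    gcongr
  induction m with
  | zero =>
    intro S y hy n hS
    refine piercedBy_step hab hm (φ := fun _ => 1) (fun S y hy n _ => ?_) ?_ (hmono 0) n S y hy hS
    · exact ⟨{y}, by simp, fun i hi => ⟨y, mem_singleton_self _,
        fun s => (hy i hi s (Nat.zero_le _)).1, fun s => (hy i hi s (Nat.zero_le _)).2⟩⟩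
    · intro n u v _ _ _ h
      simpa using h
  | succ m ih =>
    intro S y hy n hS
    refine piercedBy_step hab hm (ih (by lia)) ?_ (hmono (m + 1)) n S y hy hS
    intro n u v hn hu hv huv
    have hlog : ∀ w, w ≤ n / 2 → w * (1 + Nat.log 2 w) ^ (m + 1) ≤
        w * ((1 + Nat.log 2 n) ^ m * Nat.log 2 n) := by
      intro w hw
      rcases Nat.eq_zero_or_pos w with rfl | hw0
      · simp
      · have h₁ : 1 + Nat.log 2 w ≤ Nat.log 2 n := by
          have h₂ : Nat.log 2 w ≤ Nat.log 2 (n / 2) := Nat.log_mono_right hw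
          have h₃ : Nat.log 2 n = Nat.log 2 (n / 2) + 1 :=
            Nat.log_of_one_lt_of_le (by norm_num) (by lia)
          lia
        rw [pow_succ]
        gcongr
        lia
    have h₁ := hlog u hu
    have h₂ := hlog v hv
    set X := (1 + Nat.log 2 n) ^ m
    have h₃ : (u + v) * (X * Nat.log 2 n) ≤ n * (X * Nat.log 2 n) := by
      gcongr
      lia
    have h₄ : n * (1 + Nat.log 2 n) ^ (m + 1) = n * (X * Nat.log 2 n) + n * X := by
      rw [pow_succ]
      ring
    rw [h₄]
    nlinarith

/-- The numerical consequences of `16 (log₂ p) ^ (d - 1) < q ≤ p`. -/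
lemma bounds_of_logb_pow_lt {m p q : ℕ} (hq : 2 ≤ q) (hqp : q ≤ p)
    (h : 16 * Real.logb 2 (p : ℝ) ^ m < (q : ℝ)) :
    4 * (1 + Nat.log 2 p) ^ m + 2 ≤ q ∧ 8 * (m + 1) ≤ q := by
  set L := Real.logb 2 (p : ℝ) with hL
  have hqp' : (q : ℝ) ≤ p := by exact_mod_cast hqp
  have hp2 : 2 ≤ p := hq.trans hqp
  have hpR : (2 : ℝ) ≤ p := by exact_mod_cast hp2
  have hpow : (2 : ℝ) ^ L = p := Real.rpow_logb (by norm_num) (by norm_num) (by linarith)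
  have hlog : (Nat.log 2 p : ℝ) ≤ L := by
    rw [hL, Real.le_logb_iff_rpow_le (by norm_num) (by linarith), Real.rpow_natCast]
    exact_mod_cast Nat.pow_log_le_self 2 (by lia)
  have hL1 : 1 ≤ L := by
    rw [hL, Real.le_logb_iff_rpow_le (by norm_num) (by linarith)]
    simpa using hpR
  have hone : (1 : ℝ) ≤ L ^ m := one_le_pow₀ hL1
  have hL2 : 2 ≤ L := by
    rw [hL, Real.le_logb_iff_rpow_le (by norm_num) (by linarith)]
    have h4 : (4 : ℝ) ≤ p := by linarith
    norm_num
    exact_mod_cast h4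
  have hLm : (2 : ℝ) ^ m ≤ L ^ m := by gcongr
  have hm1 : (m : ℝ) + 1 ≤ 2 ^ m := by
    exact_mod_cast Nat.lt_two_pow_self (n := m)
  have hmL : (m : ℝ) ≤ L := by
    have h₁ : (2 : ℝ) ^ (m : ℝ) ≤ 2 ^ L := by
      rw [hpow, Real.rpow_natCast]
      nlinarith
    exact (Real.rpow_le_rpow_left_iff (by norm_num)).1 h₁
  have hexp : (1 + L) ^ m ≤ 3 * L ^ m := by
    have hLpos : 0 < L := by linarith
    have h₁ : (1 + L) ^ m = L ^ m * (1 / L + 1) ^ m := by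
      rw [← mul_pow]
      congr 1
      field_simp
    have h₂ : (1 / L + 1) ^ m ≤ 3 := by
      calc (1 / L + 1) ^ m ≤ Real.exp (1 / L) ^ m := by
            gcongr
            exact Real.add_one_le_exp _
        _ = Real.exp (m * (1 / L)) := (Real.exp_nat_mul _ _).symm
        _ ≤ Real.exp 1 := by
            gcongr
            rw [mul_one_div, div_le_one hLpos]
            exact hmL
        _ ≤ 3 := by linarith [Real.exp_one_lt_d9]
    rw [h₁]
    nlinarith [pow_pos hLpos m]
  constructor
  · have h₁ : ((1 : ℝ) + Nat.log 2 p) ^ m ≤ (1 + L) ^ m := by gcongr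
    have h₂ : (4 : ℝ) * (1 + Nat.log 2 p) ^ m + 2 ≤ q := by linarith
    exact_mod_cast h₂
  · have h₂ : (8 : ℝ) * (m + 1) ≤ q := by linarith
    exact_mod_cast h₂

/-- The local form of the `(p,q)`-property for boxes. -/
lemma exists_cliq_of_hasPQ [Fintype ι] [DecidableEq ι] {p q : ℕ} (hqp : q ≤ p)
    (h : HasPQ (fun i => Set.Icc (a i) (b i)) p q) (G : Finset ι) (hG : G.card ≤ p) :
    ∃ K ⊆ G, IsCliq a b K ∧ G.card ≤ K.card + (p - q) := by
  obtain ⟨J, hGJ, hJ⟩ := exists_superset_card_eq hG h.1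
  obtain ⟨K, hKJ, hKc, x, hx⟩ := h.2 J hJ
  simp only [Set.mem_iInter] at hx
  refine ⟨G ∩ K, inter_subset_left, fun i hi j hj => ?_, ?_⟩
  · have hi' := hx i (mem_inter.1 hi).2
    have hj' := hx j (mem_inter.1 hj).2
    exact ⟨hi'.1.trans hj'.2, hj'.1.trans hi'.2⟩
  · have h₁ := card_union_add_card_inter G K
    have h₂ := card_le_card (union_subset hGJ hKJ)
    lia

end BoxPiercing

open BoxPiercing in
/-- Theorem 1.6: there is a universal constant `c > 0` such that
`HD_{d-box}(p,q) = p - q + 1` holds for all `q > c·(log₂ p)^(d-1)`. -/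
theorem box_tight_pq :
    ∃ c : ℝ, 0 < c ∧
      ∀ (d : ℕ), 1 ≤ d →
        ∀ (ι : Type) [Fintype ι], ∀ F : ι → Set (Fin d → ℝ),
          (∀ i, IsBox (F i)) →
          ∀ p q : ℕ, 2 ≤ q → q ≤ p →
            c * (Real.logb 2 (p : ℝ)) ^ (d - 1) < (q : ℝ) →
            HasPQ F p q →
            ∃ P : Finset (Fin d → ℝ), P.card ≤ p - q + 1 ∧ Pierces F P := by
  classical
  refine ⟨16, by norm_num, fun d hd ι _ F hF p q hq hqp hlog hPQ => ?_⟩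
  choose a b hab hFab using hF
  obtain rfl : F = fun i => Set.Icc (a i) (b i) := funext hFab
  obtain ⟨h₁, h₂⟩ := bounds_of_logb_pow_lt hq hqp hlog
  have hloc := exists_cliq_of_hasPQ hqp hPQ
  have hνp : packingNumber a b Finset.univ ≤ p := by
    obtain ⟨D, -, hD, hDc⟩ := exists_isPacking a b Finset.univ
    by_contra! hlt
    obtain ⟨G, hG, hGc⟩ := Finset.exists_subset_card_eq (hDc ▸ hlt.le)
    obtain ⟨K, hK, hcl, hKc⟩ := hloc G hGc.le
    have := hcl.card_inter_le_one hD
    rw [Finset.inter_eq_left.2 (hK.trans hG)] at this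
    lia
  have hf : ∀ G : Finset ι, PiercedBy a b G
      (packingNumber a b G * (1 + Nat.log 2 p) ^ (d - 1)) := by
    intro G
    refine (piercedBy_of_free_coordinates hab (d - 1) (by lia) G 0
      (fun i _ s hs => absurd s.2 (by lia)) _ le_rfl).mono subset_rfl ?_
    have := Nat.log_mono_right (b := 2) ((packingNumber_mono (Finset.subset_univ G)).trans hνp)
    gcongr
  obtain ⟨P, hP, h⟩ := piercedBy_of_local hab (D := p - q) (q := q)
    (fun G hG => hloc G (by lia)) hf h₁ (by lia)
  exact ⟨P, hP, fun i => h i (Finset.mem_univ i)⟩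
end

section
/- Let d ≥ 1 and let F be a finite indexed family of nonempty compact convex sets in ℝ^d with Helly number 2, i.e., every pairwise-intersecting subfamily of F has a common point. If F satisfies the (p,2)-property for an integer p ≥ 2, then F can be pierced by at most p^{2d−1}/2^{d−1} points. -/
theorem Convex.exists_mem_eq_of_le_of_le {E : Type*} [NormedAddCommGroup E] [NormedSpace ℝ E]
    {C : Set E} (hC : Convex ℝ C) (f : StrongDual ℝ E) {x y : E} (hx : x ∈ C) (hy : y ∈ C)
    {u : ℝ} (hxu : f x ≤ u) (huy : u ≤ f y) : ∃ z ∈ C, f z = u := by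
  obtain ⟨z, hz, hzu⟩ :=
    hC.isPreconnected.intermediate_value hx hy f.continuous.continuousOn ⟨hxu, huy⟩
  exact ⟨z, hz, hzu⟩

/-- A family of compact convex sets on a line without `n + 1` pairwise disjoint members is pierced
by `n` points. -/
theorem exists_pierces_of_injective {ι E : Type*} [NormedAddCommGroup E] [NormedSpace ℝ E]
    (f : StrongDual ℝ E) (hf : Function.Injective f) (F : ι → Set E) (n : ℕ) (S : Finset ι)
    (hne : ∀ i ∈ S, (F i).Nonempty) (hcpt : ∀ i ∈ S, IsCompact (F i))
    (hconv : ∀ i ∈ S, Convex ℝ (F i))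
    (hind : ∀ T ⊆ S, (T : Set ι).PairwiseDisjoint F → T.card ≤ n) :
    ∃ P : Finset E, P.card ≤ n ∧ ∀ i ∈ S, ∃ x ∈ P, x ∈ F i := by
  classical
  induction n generalizing S with
  | zero =>
    refine ⟨∅, le_rfl, fun i hi => ?_⟩
    have := hind {i} (by simpa using hi) (by simp)
    simp at this
  | succ n ih =>
    rcases S.eq_empty_or_nonempty with rfl | hS
    · exact ⟨∅, by simp, by simp⟩
    have hmax : ∀ i ∈ S, ∃ x ∈ F i, IsMaxOn f (F i) x := fun i hi =>
      (hcpt i hi).exists_isMaxOn (hne i hi) f.continuous.continuousOn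
    choose! m hm hmmax using hmax
    obtain ⟨a, ha, hamin⟩ := S.exists_min_image (fun i => f (m i)) hS
    have hsub : S.filter (fun b => Disjoint (F a) (F b)) ⊆ S := Finset.filter_subset _ _
    obtain ⟨P, hPcard, hP⟩ := ih (S.filter fun b => Disjoint (F a) (F b))
      (fun i hi => hne i (hsub hi)) (fun i hi => hcpt i (hsub hi))
      (fun i hi => hconv i (hsub hi)) (fun T hT hTd => by
        have haT : a ∉ T := fun h => by
          have := (Finset.mem_filter.1 (hT h)).2
          rw [disjoint_self] at this
          exact (hne a ha).ne_empty this
        have := hind (insert a T) (Finset.insert_subset ha (hT.trans hsub)) (by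
          rw [Finset.coe_insert]
          exact hTd.insert fun j hj _ => (Finset.mem_filter.1 (hT hj)).2)
        rw [Finset.card_insert_of_notMem haT] at this
        omega)
    refine ⟨insert (m a) P, (Finset.card_insert_le _ _).trans (by omega), fun i hi => ?_⟩
    by_cases hd : Disjoint (F a) (F i)
    · obtain ⟨x, hx, hxi⟩ := hP i (Finset.mem_filter.2 ⟨hi, hd⟩)
      exact ⟨x, Finset.mem_insert_of_mem hx, hxi⟩
    · obtain ⟨x, hxa, hxi⟩ := Set.not_disjoint_iff.1 hd
      obtain ⟨z, hz, hzm⟩ := (hconv i hi).exists_mem_eq_of_le_of_le f hxi (hm i hi)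
        (hmmax a ha hxa) (hamin i hi)
      exact ⟨m a, Finset.mem_insert_self _ _, hf hzm ▸ hz⟩

/-- The number of points needed to pierce a family in dimension `d + 1` with Helly number 2 and at
most `n` pairwise disjoint members, as given by induction on the dimension. -/
def piercingBound (n : ℕ) : ℕ → ℕ
  | 0 => n
  | d + 1 => n.choose 2 * piercingBound n d + n

/-- If the members meeting any two given disjoint members are pierced by `k` points, then a family
with Helly number 2 and at most `n` pairwise disjoint members is pierced by `n.choose 2 * k + n`
points. -/
theorem exists_pierces_of_pairs {ι E : Type*} (F : ι → Set E) (n k : ℕ) (S : Finset ι)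
    (hne : ∀ i ∈ S, (F i).Nonempty)
    (helly : ∀ T ⊆ S, (∀ i ∈ T, ∀ j ∈ T, (F i ∩ F j).Nonempty) → (⋂ i ∈ T, F i).Nonempty)
    (hind : ∀ T ⊆ S, (T : Set ι).PairwiseDisjoint F → T.card ≤ n)
    (hpair : ∀ a ∈ S, ∀ b ∈ S, Disjoint (F a) (F b) → ∃ P : Finset E, P.card ≤ k ∧
      ∀ i ∈ S, ¬ Disjoint (F a) (F i) → ¬ Disjoint (F b) (F i) → ∃ x ∈ P, x ∈ F i) :
    ∃ P : Finset E, P.card ≤ n.choose 2 * k + n ∧ ∀ i ∈ S, ∃ x ∈ P, x ∈ F i := by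
  classical
  rcases S.eq_empty_or_nonempty with rfl | ⟨i₀, hi₀⟩
  · exact ⟨∅, by simp, by simp⟩
  have : Nonempty E := (hne i₀ hi₀).nonempty
  obtain ⟨T, hT, hTmax⟩ := (S.powerset.filter
    fun T : Finset ι => (T : Set ι).PairwiseDisjoint F).exists_max_image Finset.card ⟨∅, by simp⟩
  simp only [Finset.mem_filter, Finset.mem_powerset, and_imp] at hT hTmax
  obtain ⟨hTS, hTd⟩ := hT
  have hpair' : ∀ e ∈ T.powersetCard 2, ∃ P : Finset E, P.card ≤ k ∧
      ∀ i ∈ S, (∀ a ∈ e, ¬ Disjoint (F a) (F i)) → ∃ x ∈ P, x ∈ F i := by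
    intro e he
    rw [Finset.mem_powersetCard] at he
    obtain ⟨a, b, hab, rfl⟩ := Finset.card_eq_two.1 he.2
    have haT : a ∈ T := he.1 (by simp)
    have hbT : b ∈ T := he.1 (by simp)
    obtain ⟨P, hPc, hP⟩ := hpair a (hTS haT) b (hTS hbT) (hTd haT hbT hab)
    exact ⟨P, hPc, fun i hi h => hP i hi (h a (by simp)) (h b (by simp))⟩
  choose! P hPcard hP using hpair'
  have hsingle : ∀ a ∈ T, ∃ x, ∀ i ∈ S, (∀ b ∈ T, ¬ Disjoint (F b) (F i) ↔ b = a) → x ∈ F i := by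
    intro a ha
    obtain ⟨x, hx⟩ := helly (S.filter fun i => ∀ b ∈ T, ¬ Disjoint (F b) (F i) ↔ b = a)
      (Finset.filter_subset _ _) (by
        intro i hi j hj
        rw [Finset.mem_filter] at hi hj
        rw [← Set.not_disjoint_iff_nonempty_inter]
        intro hij
        have hnotMem : ∀ i ∈ S, (∀ b ∈ T, ¬ Disjoint (F b) (F i) ↔ b = a) → i ∉ T.erase a := by
          intro i hi h hiT
          rw [Finset.mem_erase] at hiT
          refine hiT.1 ((h i hiT.2).1 fun hd => (hne i hi).ne_empty ?_)
          exact disjoint_self.1 hd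
        have hdisj : ∀ i, (∀ b ∈ T, ¬ Disjoint (F b) (F i) ↔ b = a) →
            ∀ b ∈ T.erase a, Disjoint (F i) (F b) := by
          intro i h b hb
          rw [Finset.mem_erase] at hb
          by_contra hd
          exact hb.1 ((h b hb.2).1 fun h' => hd h'.symm)
        have hne' : i ≠ j := by
          rintro rfl
          exact (hne i hi.1).ne_empty (disjoint_self.1 hij)
        have hle := hTmax (insert i (insert j (T.erase a)))
          (Finset.insert_subset hi.1 (Finset.insert_subset hj.1
            ((Finset.erase_subset _ _).trans hTS))) (by
            rw [Finset.coe_insert, Finset.coe_insert]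
            refine ((hTd.subset (Finset.coe_subset.2 (Finset.erase_subset a T))).insert
              fun b hb _ => hdisj j hj.2 b hb).insert fun b hb _ => ?_
            rcases hb with rfl | hb
            · exact hij
            · exact hdisj i hi.2 b hb)
        rw [Finset.card_insert_of_notMem (by
            rw [Finset.mem_insert, not_or]; exact ⟨hne', hnotMem i hi.1 hi.2⟩),
          Finset.card_insert_of_notMem (hnotMem j hj.1 hj.2),
          Finset.card_erase_add_one ha] at hle
        omega)
    simp only [Set.mem_iInter, Finset.mem_filter, and_imp] at hx
    exact ⟨x, hx⟩
  choose! x hx using hsingle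
  have hTn : T.card ≤ n := hind T hTS hTd
  refine ⟨(T.powersetCard 2).biUnion P ∪ T.image x, ?_, fun i hi => ?_⟩
  · refine (Finset.card_union_le _ _).trans (add_le_add ?_ (Finset.card_image_le.trans hTn))
    refine (Finset.card_biUnion_le_card_mul _ _ k hPcard).trans ?_
    rw [Finset.card_powersetCard]
    exact Nat.mul_le_mul_right _ (Nat.choose_le_choose 2 hTn)
  · set N := T.filter fun a => ¬ Disjoint (F a) (F i) with hN
    rcases lt_or_ge N.card 2 with hlt | hge
    · have hNne : N.Nonempty := by
        by_contra hemp
        rw [Finset.not_nonempty_iff_eq_empty, hN, Finset.filter_eq_empty_iff] at hemp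
        simp only [not_not] at hemp
        have hiT : i ∉ T := fun h => (hne i hi).ne_empty (disjoint_self.1 (hemp h))
        have := hTmax (insert i T) (Finset.insert_subset hi hTS) (by
          rw [Finset.coe_insert]
          exact hTd.insert fun b hb _ => (hemp hb).symm)
        rw [Finset.card_insert_of_notMem hiT] at this
        omega
      obtain ⟨a, ha⟩ := Finset.card_eq_one.1 (by have := hNne.card_pos; omega : N.card = 1)
      have haT : a ∈ T := (Finset.mem_filter.1 (ha ▸ Finset.mem_singleton_self a : a ∈ N)).1
      refine ⟨x a, Finset.mem_union_right _ (Finset.mem_image_of_mem _ haT),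
        hx a haT i hi fun b hb => ?_⟩
      rw [← Finset.mem_singleton, ← ha, hN, Finset.mem_filter]
      simp [hb]
    · obtain ⟨e, heN, he⟩ := Finset.exists_subset_card_eq hge
      have heT : e ∈ T.powersetCard 2 :=
        Finset.mem_powersetCard.2 ⟨heN.trans (Finset.filter_subset _ _), he⟩
      obtain ⟨y, hy, hyi⟩ := hP e heT i hi fun a ha => (Finset.mem_filter.1 (heN ha)).2
      exact ⟨y, Finset.mem_union_left _ (Finset.mem_biUnion.2 ⟨e, heT, hy⟩), hyi⟩

open Module in
/-- A family of compact convex sets in dimension `d + 1` with Helly number 2 and at most `n` pairwise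
disjoint members is pierced by `piercingBound n d` points. The sets meeting two disjoint members are
replaced by their sections with a separating hyperplane: these still have Helly number 2 and the
same intersection pattern. -/
theorem exists_pierces_of_helly {ι : Type*} (n d : ℕ) (E : Type*) [NormedAddCommGroup E]
    [NormedSpace ℝ E] [FiniteDimensional ℝ E] (hE : finrank ℝ E = d + 1) (F : ι → Set E)
    (S : Finset ι) (hne : ∀ i ∈ S, (F i).Nonempty) (hcpt : ∀ i ∈ S, IsCompact (F i))
    (hconv : ∀ i ∈ S, Convex ℝ (F i))
    (helly : ∀ T ⊆ S, (∀ i ∈ T, ∀ j ∈ T, (F i ∩ F j).Nonempty) → (⋂ i ∈ T, F i).Nonempty)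
    (hind : ∀ T ⊆ S, (T : Set ι).PairwiseDisjoint F → T.card ≤ n) :
    ∃ P : Finset E, P.card ≤ piercingBound n d ∧ ∀ i ∈ S, ∃ x ∈ P, x ∈ F i := by
  classical
  induction d generalizing E S with
  | zero =>
    let e : E ≃ₗ[ℝ] ℝ := LinearEquiv.ofFinrankEq E ℝ (by simp [hE])
    exact exists_pierces_of_injective e.toContinuousLinearEquiv.toContinuousLinearMap
      e.injective F n S hne hcpt hconv hind
  | succ d ih =>
    refine exists_pierces_of_pairs F n _ S hne helly hind fun a ha b hb hab => ?_
    obtain ⟨f, u, v, hfa, huv, hfb⟩ := geometric_hahn_banach_compact_closed (hconv a ha)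
      (hcpt a ha) (hconv b hb) (hcpt b hb).isClosed hab
    have hsurj : Function.Surjective f := by
      refine LinearMap.surjective (f := (f : E →ₗ[ℝ] ℝ)) fun h0 => ?_
      obtain ⟨x, hx⟩ := hne a ha
      obtain ⟨y, hy⟩ := hne b hb
      have h1 : f x = 0 := LinearMap.congr_fun h0 x
      have h2 : f y = 0 := LinearMap.congr_fun h0 y
      have := hfa x hx
      have := hfb y hy
      linarith
    obtain ⟨x₀, hx₀⟩ := hsurj u
    let K := LinearMap.ker (f : E →ₗ[ℝ] ℝ)
    have hK : finrank ℝ K = d + 1 := by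
      have := (f : E →ₗ[ℝ] ℝ).finrank_range_add_finrank_ker
      rw [LinearMap.range_eq_top.2 hsurj, finrank_top, finrank_self, hE] at this
      change finrank ℝ (LinearMap.ker (f : E →ₗ[ℝ] ℝ)) = d + 1
      omega
    let φ : K → E := fun y => x₀ + y
    set S' := S.filter fun i => ¬ Disjoint (F a) (F i) ∧ ¬ Disjoint (F b) (F i) with hS'
    have hS'S : S' ⊆ S := Finset.filter_subset _ _
    have hinter : ∀ T ⊆ S', (∀ i ∈ T, ∀ j ∈ T, (F i ∩ F j).Nonempty) →
        (⋂ i ∈ T, φ ⁻¹' F i).Nonempty := by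
      intro T hT hTi
      have hext : ∀ c ∈ S, (∀ i ∈ S', ¬ Disjoint (F c) (F i)) →
          ∃ x ∈ F c, x ∈ ⋂ i ∈ T, F i := by
        intro c hc hcS'
        obtain ⟨x, hx⟩ := helly (insert c T) (Finset.insert_subset hc (hT.trans hS'S)) (by
          simp only [Finset.forall_mem_insert]
          refine ⟨⟨by simpa using hne c hc, fun j hj => ?_⟩, fun i hi => ⟨?_, hTi i hi⟩⟩
          · exact Set.not_disjoint_iff_nonempty_inter.1 (hcS' j (hT hj))
          · rw [Set.inter_comm]
            exact Set.not_disjoint_iff_nonempty_inter.1 (hcS' i (hT hi)))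
        rw [Finset.set_biInter_insert] at hx
        exact ⟨x, hx⟩
      obtain ⟨x, hxa, hx⟩ := hext a ha fun i hi => (Finset.mem_filter.1 hi).2.1
      obtain ⟨y, hyb, hy⟩ := hext b hb fun i hi => (Finset.mem_filter.1 hi).2.2
      have hC : Convex ℝ (⋂ i ∈ T, F i) :=
        convex_iInter₂ fun i hi => hconv i (hS'S (hT hi))
      obtain ⟨z, hz, hzu⟩ := hC.exists_mem_eq_of_le_of_le f hx hy (hfa x hxa).le
        (huv.trans (hfb y hyb)).le
      refine ⟨⟨z - x₀, by simp [K, hzu, hx₀]⟩, ?_⟩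
      simpa [φ] using hz
    have hsec : ∀ i ∈ S', ∀ j ∈ S', (F i ∩ F j).Nonempty → (φ ⁻¹' F i ∩ φ ⁻¹' F j).Nonempty := by
      intro i hi j hj hij
      have := hinter {i, j} (by simp [Finset.insert_subset_iff, hi, hj]) (by
        simpa [Set.inter_comm (F j), hij] using ⟨hne i (hS'S hi), hne j (hS'S hj)⟩)
      simpa [Finset.set_biInter_insert] using this
    obtain ⟨P, hPc, hP⟩ := ih K hK (fun i => φ ⁻¹' F i) S'
      (fun i hi => by
        simpa using hsec i hi i hi (by simpa using hne i (hS'S hi)))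
      (fun i hi => by
        have hφ : Topology.IsClosedEmbedding φ :=
          (Homeomorph.addLeft x₀).isClosedEmbedding.comp
            K.closed_of_finiteDimensional.isClosedEmbedding_subtypeVal
        exact hφ.isCompact_preimage (hcpt i (hS'S hi)))
      (fun i hi => ((hconv i (hS'S hi)).translate_preimage_right x₀).linear_preimage K.subtype)
      (fun T hT h => hinter T hT fun i hi j hj => (h i hi j hj).imp' φ fun _ h => h)
      (fun T hT h => hind T (hT.trans hS'S) fun i hi j hj hij => by
        by_contra hd
        exact (Set.not_disjoint_iff_nonempty_inter.2
          (hsec i (hT hi) j (hT hj) (Set.not_disjoint_iff_nonempty_inter.1 hd))) (h hi hj hij))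
    refine ⟨P.image φ, Finset.card_image_le.trans hPc, fun i hi hai hbi => ?_⟩
    obtain ⟨y, hy, hyi⟩ := hP i (Finset.mem_filter.2 ⟨hi, hai, hbi⟩)
    exact ⟨φ y, Finset.mem_image_of_mem _ hy, hyi⟩

theorem le_pow_div_two_pow (d : ℕ) {p : ℝ} (hp : 2 ≤ p) : p ≤ p ^ (2 * d + 1) / 2 ^ d := by
  rw [le_div_iff₀ (by positivity), pow_succ, pow_mul, mul_comm]
  gcongr
  nlinarith

theorem piercingBound_le (d : ℕ) {p : ℕ} (hp : 2 ≤ p) :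
    (piercingBound (p - 1) d : ℝ) ≤ (p : ℝ) ^ (2 * d + 1) / 2 ^ d := by
  have hp' : (2 : ℝ) ≤ p := by exact_mod_cast hp
  have hsub : ((p - 1 : ℕ) : ℝ) = p - 1 := by
    rw [Nat.cast_sub (by omega), Nat.cast_one]
  induction d with
  | zero => simp [piercingBound, hsub]
  | succ d ih =>
    have hX := le_pow_div_two_pow d hp'
    set X := (p : ℝ) ^ (2 * d + 1) / 2 ^ d with hXdef
    have hstep : (p : ℝ) ^ (2 * (d + 1) + 1) / 2 ^ (d + 1) = p ^ 2 / 2 * X := by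
      rw [hXdef]
      field_simp
      ring
    rw [hstep, piercingBound, Nat.cast_add, Nat.cast_mul, Nat.cast_choose_two, hsub]
    have hc : (0 : ℝ) ≤ (p - 1) * (p - 1 - 1) / 2 := by
      apply div_nonneg (mul_nonneg _ _) <;> linarith
    nlinarith [mul_le_mul_of_nonneg_left ih hc]

theorem HasPQ.card_lt_of_pairwiseDisjoint {ι α : Type*} [Fintype ι] {F : ι → Set α} {p : ℕ}
    (h : HasPQ F p 2) {T : Finset ι} (hT : (T : Set ι).PairwiseDisjoint F) : T.card < p := by
  classical
  by_contra! hle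
  obtain ⟨J, hJT, hJ⟩ := Finset.exists_subset_card_eq hle
  obtain ⟨K, hKJ, hK, x, hx⟩ := h.2 J hJ
  obtain ⟨i, j, hij, rfl⟩ := Finset.card_eq_two.1 hK
  have hx' : x ∈ F i ∧ x ∈ F j := by simpa using hx
  exact Set.disjoint_left.1 (hT (hJT (hKJ (by simp))) (hJT (hKJ (by simp))) hij) hx'.1 hx'.2

/-- Theorem 1.7 (first part): a family of nonempty compact convex sets in `ℝ^d`
with Helly number 2 that satisfies the `(p,2)`-property can be pierced by at
most `p^(2d-1)/2^(d-1)` points. -/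
theorem helly2_p2_theorem (d : ℕ) (hd : 1 ≤ d) {ι : Type} [Fintype ι]
    (F : ι → Set (Fin d → ℝ))
    (hne : ∀ i, (F i).Nonempty)
    (hcpt : ∀ i, IsCompact (F i))
    (hconv : ∀ i, Convex ℝ (F i))
    (helly : ∀ S : Finset ι,
      (∀ i ∈ S, ∀ j ∈ S, (F i ∩ F j).Nonempty) → (⋂ i ∈ S, F i).Nonempty)
    (p : ℕ) (hp : 2 ≤ p)
    (hpq : HasPQ F p 2) :
    ∃ P : Finset (Fin d → ℝ),
      (P.card : ℝ) ≤ (p : ℝ) ^ (2 * d - 1) / 2 ^ (d - 1) ∧ Pierces F P := by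
  obtain ⟨d, rfl⟩ : ∃ k, d = k + 1 := ⟨d - 1, by omega⟩
  obtain ⟨P, hPc, hP⟩ := exists_pierces_of_helly (p - 1) d (Fin (d + 1) → ℝ) (by simp) F
    Finset.univ (fun i _ => hne i) (fun i _ => hcpt i) (fun i _ => hconv i)
    (fun T _ => helly T)
    (fun T _ hT => Nat.le_sub_one_of_lt (hpq.card_lt_of_pairwiseDisjoint hT))
  exact ⟨P, (Nat.cast_le.2 hPc).trans (piercingBound_le d hp), fun i => hP i (Finset.mem_univ i)⟩
end

section
/- For all integers d ≥ 1, t ≥ 1 and p ≥ 2 there exists s = s(p,d,t) ∈ ℕ such that every finite indexed family F of nonempty compact convex sets in ℝ^d with the following two properties can be pierced by at most s points: (i) every pairwise-intersecting subfamily of F can be pierced by at most t points; (ii) F satisfies the (p,2)-property. -/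
section TupleWeight

variable {ι B : Type*} [Fintype ι] [Fintype B]

open Classical in
/-- The measure of a set of `B`-tuples under the product of the weight `w`. -/
noncomputable def tupleWeight (w : ι → ℝ) (A : Set (B → ι)) : ℝ :=
  ∑ f, A.indicator (fun f => ∏ b, w (f b)) f

theorem tupleWeight_univ {w : ι → ℝ} (hw : ∑ i, w i = 1) :
    tupleWeight w (Set.univ : Set (B → ι)) = 1 := by
  classical
  have h := Finset.prod_univ_sum (fun _ : B => (Finset.univ : Finset ι)) (fun _ i => w i)
  rw [Fintype.piFinset_univ] at h
  simp only [tupleWeight, Set.indicator_univ]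
  convert h.symm using 1
  simp [hw]

theorem tupleWeight_mono {w : ι → ℝ} (hw : ∀ i, 0 ≤ w i) {A A' : Set (B → ι)} (h : A ⊆ A') :
    tupleWeight w A ≤ tupleWeight w A' :=
  Finset.sum_le_sum fun _ _ =>
    Set.indicator_le_indicator_of_subset h (fun _ => Finset.prod_nonneg fun _ _ => hw _) _

theorem tupleWeight_union {w : ι → ℝ} {A A' : Set (B → ι)} (h : Disjoint A A') :
    tupleWeight w (A ∪ A') = tupleWeight w A + tupleWeight w A' := by
  simp only [tupleWeight, Set.indicator_union_of_disjoint h, Finset.sum_add_distrib]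

/-- If every tuple satisfies one of finitely many conditions, some condition holds with large
weight. -/
theorem exists_inv_card_le_tupleWeight {C : Type*} [Fintype C] {w : ι → ℝ} (hw : ∀ i, 0 ≤ w i)
    (hw1 : ∑ i, w i = 1) (Q : C → (B → ι) → Prop) (h : ∀ f, ∃ c, Q c f) :
    ∃ c, 1 / ((Fintype.card C : ℝ) + 1) ≤ tupleWeight w {f | Q c f} := by
  classical
  by_contra! hlt
  have h1 : (1 : ℝ) ≤ ∑ c, tupleWeight w {f | Q c f} := by
    rw [← tupleWeight_univ (B := B) hw1]
    simp only [tupleWeight]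
    rw [Finset.sum_comm]
    refine Finset.sum_le_sum fun f _ => ?_
    obtain ⟨c, hc⟩ := h f
    have hnn : ∀ f : B → ι, 0 ≤ ∏ b, w (f b) := fun f => Finset.prod_nonneg fun _ _ => hw _
    calc _ = Set.indicator {f | Q c f} (fun f => ∏ b, w (f b)) f := by simp [hc]
      _ ≤ _ := Finset.single_le_sum
        (f := fun c => Set.indicator {f | Q c f} (fun f => ∏ b, w (f b)) f)
        (fun c _ => Set.indicator_nonneg (fun f _ => hnn f) f) (Finset.mem_univ c)
  have h2 : ∑ c, tupleWeight w {f | Q c f} ≤ ∑ _c : C, 1 / ((Fintype.card C : ℝ) + 1) :=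
    Finset.sum_le_sum fun c _ => (hlt c).le
  have h3 : ∑ _c : C, 1 / ((Fintype.card C : ℝ) + 1) < 1 := by
    simp only [Finset.sum_const, Finset.card_univ, nsmul_eq_mul]
    rw [mul_one_div, div_lt_one (by positivity)]
    linarith
  linarith

/-- If `Q f g` depends only on the coordinates of `f` outside `S` and of `g` inside `S`, then
`f` can be fixed without decreasing the weight of the diagonal. -/
theorem exists_le_tupleWeight_of_diagonal {w : ι → ℝ} (hw : ∀ i, 0 ≤ w i)
    (hw1 : ∑ i, w i = 1) (S : Set B) (Q : (B → ι) → (B → ι) → Prop)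
    (hQ : ∀ f f' g g', (∀ b ∉ S, f b = f' b) → (∀ b ∈ S, g b = g' b) → Q f g → Q f' g')
    {α : ℝ} (h : α ≤ tupleWeight w {f | Q f f}) :
    ∃ f, α ≤ tupleWeight w {g | Q f g} := by
  classical
  by_contra! hlt
  let W : (B → ι) → ℝ := fun f => ∏ b, w (f b)
  have hW0 : ∀ f, 0 ≤ W f := fun f => Finset.prod_nonneg fun _ _ => hw _
  have hW1 : ∑ f, W f = 1 := by
    have := tupleWeight_univ (B := B) hw1
    simpa [tupleWeight] using this
  let e : (B → ι) × (B → ι) ≃ (B → ι) × (B → ι) :=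
    { toFun := fun q => (S.piecewise q.2 q.1, S.piecewise q.1 q.2)
      invFun := fun q => (S.piecewise q.2 q.1, S.piecewise q.1 q.2)
      left_inv := fun q => by
        ext b <;> by_cases hb : b ∈ S <;> simp [hb]
      right_inv := fun q => by
        ext b <;> by_cases hb : b ∈ S <;> simp [hb] }
  have hWe : ∀ q, W (e q).1 * W (e q).2 = W q.1 * W q.2 := by
    intro q
    simp only [W, ← Finset.prod_mul_distrib]
    refine Finset.prod_congr rfl fun b _ => ?_
    by_cases hb : b ∈ S <;> simp [e, hb, mul_comm]
  have hQe : ∀ q, Q q.1 q.2 ↔ Q (e q).1 (e q).1 := by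
    intro q
    constructor
    · refine hQ _ _ _ _ (fun b hb => ?_) (fun b hb => ?_) <;> simp [e, hb]
    · refine hQ _ _ _ _ (fun b hb => ?_) (fun b hb => ?_) <;> simp [e, hb]
  have key : ∑ f, W f * tupleWeight w {g | Q f g} = tupleWeight w {f | Q f f} := by
    calc ∑ f, W f * tupleWeight w {g | Q f g}
        = ∑ q : (B → ι) × (B → ι), if Q q.1 q.2 then W q.1 * W q.2 else 0 := by
          rw [Fintype.sum_prod_type]
          refine Finset.sum_congr rfl fun f _ => ?_
          simp only [tupleWeight, Finset.mul_sum]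
          refine Finset.sum_congr rfl fun g _ => ?_
          simp [Set.indicator_apply, W]
      _ = ∑ q : (B → ι) × (B → ι), if Q (e q).1 (e q).1 then W (e q).1 * W (e q).2 else 0 := by
          simp only [hWe, hQe]
      _ = ∑ q : (B → ι) × (B → ι), if Q q.1 q.1 then W q.1 * W q.2 else 0 :=
          Equiv.sum_comp e (fun q => if Q q.1 q.1 then W q.1 * W q.2 else 0)
      _ = _ := by
          rw [Fintype.sum_prod_type]
          simp only [tupleWeight]
          refine Finset.sum_congr rfl fun f _ => ?_
          by_cases hf : Q f f
          · simp [hf, ← Finset.mul_sum, hW1, W]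
          · simp [hf]
  have hle : ∑ f, W f * tupleWeight w {g | Q f g} < ∑ f, W f * α := by
    obtain ⟨f, -, hf⟩ : ∃ f ∈ Finset.univ, 0 < W f := by
      apply Finset.exists_lt_of_sum_lt
      simp [hW1]
    exact Finset.sum_lt_sum (fun f _ => mul_le_mul_of_nonneg_left (hlt f).le (hW0 f))
      ⟨f, Finset.mem_univ f, mul_lt_mul_of_pos_left (hlt f) hf⟩
  rw [← Finset.sum_mul, hW1, key] at hle
  linarith

/-- The weight of a condition on a single coordinate. -/
theorem tupleWeight_coord {w : ι → ℝ} (hw1 : ∑ i, w i = 1) (b : B) (A : Set ι) :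
    tupleWeight w {f : B → ι | f b ∈ A} = ∑ i, A.indicator w i := by
  classical
  have h := Finset.prod_univ_sum (fun _ : B => (Finset.univ : Finset ι))
    (fun c i => if c = b then A.indicator w i else w i)
  rw [Fintype.piFinset_univ] at h
  have hl : ∏ c : B, ∑ i, (if c = b then A.indicator w i else w i) = ∑ i, A.indicator w i := by
    rw [Finset.prod_eq_single b]
    · simp
    · intro c _ hc
      simp [hc, hw1]
    · simp
  rw [← hl, h, tupleWeight]
  refine Finset.sum_congr rfl fun f _ => ?_
  by_cases hf : f b ∈ A
  · rw [Set.indicator_of_mem (by exact hf)]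
    refine Finset.prod_congr rfl fun c _ => ?_
    split_ifs with hc
    · subst hc; simp [hf]
    · rfl
  · rw [Set.indicator_of_notMem (by exact hf)]
    exact (Finset.prod_eq_zero (Finset.mem_univ b) (by simp [hf])).symm

/-- Restricting a weight to `A` multiplies tuple weights by a power of the mass of `A`. -/
theorem tupleWeight_indicator_div (w : ι → ℝ) (A : Set ι) (a : ℝ) (T : Set (B → ι)) :
    tupleWeight (fun i => A.indicator w i / a) T =
      tupleWeight w {f | f ∈ T ∧ ∀ b, f b ∈ A} / a ^ Fintype.card B := by
  classical
  simp only [tupleWeight, Finset.sum_div]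
  refine Finset.sum_congr rfl fun f _ => ?_
  by_cases hT : f ∈ T
  · by_cases hA : ∀ b, f b ∈ A
    · simp [hT, hA, Finset.prod_div_distrib]
    · obtain ⟨b, hb⟩ := not_forall.1 hA
      rw [Set.indicator_of_mem hT, Set.indicator_of_notMem (by simp [hA]), zero_div]
      exact Finset.prod_eq_zero (Finset.mem_univ b) (by simp [hb])
  · simp [hT]

end TupleWeight

section MinPoint

variable {E : Type*}

open Classical in
/-- A minimiser of `q` on `K`, with a default value when there is none. -/
noncomputable def minPoint [Zero E] (q : E → ℝ) (K : Set E) : E :=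
  if h : ∃ x ∈ K, IsMinOn q K x then h.choose else 0

theorem minPoint_eq [AddCommGroup E] [Module ℝ E] {q : E → ℝ}
    (hq : StrictConvexOn ℝ Set.univ q) {K : Set E} (hK : Convex ℝ K) {x : E} (hx : x ∈ K)
    (hmin : IsMinOn q K x) : minPoint q K = x := by
  have h : ∃ x ∈ K, IsMinOn q K x := ⟨x, hx, hmin⟩
  rw [minPoint, dif_pos h]
  exact (hq.subset (Set.subset_univ K) hK).eq_of_isMinOn h.choose_spec.2 hmin h.choose_spec.1 hx

/-- The minimiser of a strictly convex function on an intersection of `d + 1` convex sets in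
dimension `d` is already the minimiser on the intersection of `d` of them. -/
theorem exists_minPoint_erase_mem [AddCommGroup E] [Module ℝ E] [FiniteDimensional ℝ E]
    [TopologicalSpace E] [T2Space E] {κ : Type*} [DecidableEq κ] {q : E → ℝ}
    (hq : StrictConvexOn ℝ Set.univ q) (hqc : Continuous q) (F : κ → Set E) (T : Finset κ)
    (hT : T.card = Module.finrank ℝ E + 1) (hc : ∀ k ∈ T, IsCompact (F k))
    (hconv : ∀ k ∈ T, Convex ℝ (F k)) (hne : (⋂ k ∈ T, F k).Nonempty) :
    ∃ k ∈ T, minPoint q (⋂ j ∈ T.erase k, F j) ∈ F k := by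
  obtain ⟨k₀, hk₀⟩ : T.Nonempty := Finset.card_pos.1 (by omega)
  have hcomp : IsCompact (⋂ k ∈ T, F k) :=
    (hc k₀ hk₀).of_isClosed_subset
      (isClosed_biInter fun k hk => (hc k hk).isClosed) (Set.biInter_subset_of_mem hk₀)
  obtain ⟨x, hx, hmin⟩ := hcomp.exists_isMinOn hne hqc.continuousOn
  have hxF : ∀ k ∈ T, x ∈ F k := by simpa using hx
  by_contra! hcon
  have hlt : ∀ k ∈ T, ∃ y, q y < q x ∧ ∀ j ∈ T.erase k, y ∈ F j := by
    intro k hk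
    by_contra! h
    refine hcon k hk ?_
    rw [minPoint_eq hq (convex_iInter₂ fun j hj => hconv j (Finset.mem_of_mem_erase hj))
      (x := x) (by simpa using fun j _ hj => hxF j hj)]
    · exact hxF k hk
    · intro y hy
      by_contra hlt
      obtain ⟨j, hj, hyj⟩ := h y (not_le.1 hlt)
      exact hyj (Set.mem_iInter₂.1 hy j hj)
  let G : Option κ → Set E := fun o => o.elim {y | q y < q x} F
  obtain ⟨y, hy⟩ := Convex.helly_theorem' (𝕜 := ℝ) (F := G) (s := Finset.insertNone T)
    (by
      rintro (_ | k) hk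
      · simpa [G] using hq.convexOn.convex_lt (q x)
      · exact hconv k (by simpa using hk))
    (by
      intro I hI hcard
      by_cases hnone : none ∈ I
      · obtain ⟨k, hk, hkI⟩ : ∃ k ∈ T, some k ∉ I := by
          by_contra! hall
          have : Finset.insertNone T ⊆ I := by
            rintro (_ | k) hk
            · exact hnone
            · exact hall k (by simpa using hk)
          have := Finset.card_le_card this
          rw [Finset.card_insertNone] at this
          omega
        obtain ⟨y, hyq, hy⟩ := hlt k hk
        refine ⟨y, Set.mem_iInter₂.2 ?_⟩
        rintro (_ | j) hj
        · exact hyq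
        · refine hy j (Finset.mem_erase.2 ⟨?_, by simpa using hI hj⟩)
          rintro rfl
          exact hkI hj
      · refine ⟨x, Set.mem_iInter₂.2 ?_⟩
        rintro (_ | j) hj
        · exact absurd hj hnone
        · exact hxF j (by simpa using hI hj))
  rw [Set.mem_iInter₂] at hy
  have hyx : q y < q x := hy none (by simp)
  have : y ∈ ⋂ k ∈ T, F k := Set.mem_iInter₂.2 fun k hk => hy (some k) (by simpa using hk)
  exact absurd (hmin this) (not_le.2 hyx)

theorem strictConvexOn_sum_sq (d : ℕ) :
    StrictConvexOn ℝ Set.univ (fun x : Fin d → ℝ => ∑ i, x i ^ 2) := by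
  refine ⟨convex_univ, fun x _ y _ hxy a b ha hb hab => ?_⟩
  obtain ⟨i₀, hi₀⟩ := Function.ne_iff.1 hxy
  have hpt : ∀ i, a * x i ^ 2 + b * y i ^ 2 - (a * x i + b * y i) ^ 2
      = a * b * (x i - y i) ^ 2 := by
    intro i
    obtain rfl : b = 1 - a := by linarith
    ring
  simp only [Pi.add_apply, Pi.smul_apply, smul_eq_mul, Finset.mul_sum, ← Finset.sum_add_distrib]
  refine Finset.sum_lt_sum (fun i _ => ?_) ⟨i₀, Finset.mem_univ _, ?_⟩
  · have := hpt i
    have : 0 ≤ a * b * (x i - y i) ^ 2 := by positivity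
    linarith
  · have := hpt i₀
    have h0 : x i₀ - y i₀ ≠ 0 := sub_ne_zero.2 hi₀
    have : 0 < a * b * (x i₀ - y i₀) ^ 2 := by positivity
    linarith

end MinPoint

/-- Iterated Radon partitions: a weak form of Tverberg's theorem. -/
theorem exists_tverberg_coloring (E : Type*) [AddCommGroup E] [Module ℝ E]
    [FiniteDimensional ℝ E] (n : ℕ) :
    ∃ (B κ : Type) (_ : Fintype B) (_ : Fintype κ), n < Fintype.card κ ∧
      ∀ x : B → E, ∃ (c : B → κ) (z : E), ∀ a, z ∈ convexHull ℝ (x '' {b | c b = a}) := by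
  induction n with
  | zero =>
    exact ⟨Unit, Unit, inferInstance, inferInstance, by simp, fun x =>
      ⟨id, x (), fun a => subset_convexHull ℝ _ ⟨(), by simp⟩⟩⟩
  | succ n ih =>
    obtain ⟨B, κ, _, _, hn, h⟩ := ih
    refine ⟨B × Fin (Module.finrank ℝ E + 2), κ × Bool, inferInstance, inferInstance, ?_, ?_⟩
    · rw [Fintype.card_prod, Fintype.card_bool]
      omega
    intro x
    choose c y hy using fun g => h fun b => x (b, g)
    have hdep : ¬ AffineIndependent ℝ y := by
      intro hi
      have h1 := hi.card_le_finrank_succ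
      have h2 := Submodule.finrank_le (vectorSpan ℝ (Set.range y))
      rw [Fintype.card_fin] at h1
      omega
    obtain ⟨I, z, hz1, hz2⟩ := Convex.radon_partition hdep
    classical
    refine ⟨fun b => (c b.2 b.1, decide (b.2 ∈ I)), z, ?_⟩
    have aux : ∀ (a : κ) (t : Bool) (J : Set (Fin (Module.finrank ℝ E + 2))),
        (∀ g ∈ J, decide (g ∈ I) = t) → convexHull ℝ (y '' J) ⊆
          convexHull ℝ (x '' {b | (c b.2 b.1, decide (b.2 ∈ I)) = (a, t)}) := by
      intro a t J hJ
      refine convexHull_min ?_ (convex_convexHull ℝ _)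
      rintro _ ⟨g, hg, rfl⟩
      refine convexHull_mono ?_ (hy g a)
      rintro _ ⟨b, hb, rfl⟩
      exact ⟨(b, g), by simpa [hJ g hg] using hb, rfl⟩
    rintro ⟨a, _ | _⟩
    · exact aux a false Iᶜ (by simp) hz2
    · exact aux a true I (by simp) hz1

theorem exists_ramsey (p m : ℕ) : ∃ N : ℕ, ∀ (α : Type) (r : α → α → Prop), (∀ {a b}, r a b → r b a) →
    ∀ A : Finset α, N ≤ A.card →
      (∃ S ⊆ A, S.card = p ∧ (S : Set α).Pairwise fun a b => ¬ r a b) ∨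
        ∃ S ⊆ A, S.card = m ∧ (S : Set α).Pairwise r := by
  induction p generalizing m with
  | zero => exact ⟨0, fun α r _ A _ => Or.inl ⟨∅, by simp⟩⟩
  | succ p ihp =>
    induction m with
    | zero => exact ⟨0, fun α r _ A _ => Or.inr ⟨∅, by simp⟩⟩
    | succ m ihm =>
      obtain ⟨N₁, h₁⟩ := ihp (m + 1)
      obtain ⟨N₂, h₂⟩ := ihm
      refine ⟨N₁ + N₂ + 1, fun α r hr A hA => ?_⟩
      classical
      obtain ⟨a, ha⟩ : A.Nonempty := Finset.card_pos.1 (by omega)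
      have hsplit := Finset.card_filter_add_card_filter_not (s := A.erase a) (fun b => r a b)
      rw [Finset.card_erase_of_mem ha] at hsplit
      have hins : ∀ (P : α → Prop) [DecidablePred P], ∀ S ⊆ (A.erase a).filter P,
          insert a S ⊆ A ∧ (insert a S).card = S.card + 1 ∧ ∀ b ∈ S, P b := by
        intro P _ S hS
        refine ⟨Finset.insert_subset ha (hS.trans ((Finset.filter_subset _ _).trans
          (Finset.erase_subset _ _))), Finset.card_insert_of_notMem fun h => ?_, fun b hb => ?_⟩
        · simpa using hS h
        · exact (Finset.mem_filter.1 (hS hb)).2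
      have hsub : ∀ (P : α → Prop) [DecidablePred P], (A.erase a).filter P ⊆ A := fun P _ =>
        (Finset.filter_subset _ _).trans (Finset.erase_subset _ _)
      by_cases hbig : N₂ ≤ ((A.erase a).filter fun b => r a b).card
      · rcases h₂ α r hr _ hbig with ⟨S, hS, hc, hp⟩ | ⟨S, hS, hc, hp⟩
        · exact Or.inl ⟨S, hS.trans (hsub _), hc, hp⟩
        · obtain ⟨h1, h2, h3⟩ := hins _ S hS
          refine Or.inr ⟨insert a S, h1, by omega, ?_⟩
          rw [Finset.coe_insert]
          exact hp.insert fun b hb _ => ⟨h3 b hb, hr (h3 b hb)⟩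
      · have hbig' : N₁ ≤ ((A.erase a).filter fun b => ¬ r a b).card := by omega
        rcases h₁ α r hr _ hbig' with ⟨S, hS, hc, hp⟩ | ⟨S, hS, hc, hp⟩
        · obtain ⟨h1, h2, h3⟩ := hins _ S hS
          refine Or.inl ⟨insert a S, h1, by omega, ?_⟩
          rw [Finset.coe_insert]
          exact hp.insert fun b hb _ => ⟨h3 b hb, fun h => h3 b hb (hr h)⟩
        · exact Or.inr ⟨S, hS.trans (hsub _), hc, hp⟩

/-- A selection lemma: some point lies in the hulls of a positive fraction of all `B`-tuples. -/
theorem exists_mem_convexHull_tuples (d : ℕ) :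
    ∃ (B : Type) (_ : Fintype B) (c : ℝ), 0 < c ∧
      ∀ (κ : Type) [Fintype κ] (x : κ → Fin d → ℝ) (w : κ → ℝ), (∀ k, 0 ≤ w k) → ∑ k, w k = 1 →
        ∃ z, c ≤ tupleWeight w {f : B → κ | z ∈ convexHull ℝ (Set.range (x ∘ f))} := by
  classical
  obtain ⟨B, κ, _, _, hκ, hcol⟩ := exists_tverberg_coloring (Fin d → ℝ) d
  obtain ⟨T, -, hT⟩ := Finset.exists_subset_card_eq
    (s := (Finset.univ : Finset κ)) (n := d + 1) (by rw [Finset.card_univ]; omega)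
  refine ⟨B, inferInstance, 1 / ((Fintype.card ((B → κ) × κ) : ℝ) + 1), by positivity, ?_⟩
  intro ι _ x w hw hw1
  let q : (Fin d → ℝ) → ℝ := fun x => ∑ i, x i ^ 2
  let H : (B → κ) → (B → ι) → κ → Set (Fin d → ℝ) := fun c f a =>
    convexHull ℝ ((x ∘ f) '' {b | c b = a})
  have hH : ∀ c f f' a, (∀ b, c b = a → f b = f' b) → H c f a = H c f' a := by
    intro c f f' a h
    simp only [H]
    congr 1
    exact Set.image_congr fun b hb => by simp [h b hb]
  let Q : (B → κ) × κ → (B → ι) → (B → ι) → Prop := fun ca f g =>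
    minPoint q (⋂ j ∈ T.erase ca.2, H ca.1 f j) ∈ H ca.1 g ca.2
  obtain ⟨⟨c, a⟩, hca⟩ := exists_inv_card_le_tupleWeight hw hw1 (fun ca f => Q ca f f) (by
    intro f
    obtain ⟨c, z, hz⟩ := hcol (x ∘ f)
    obtain ⟨a, -, ha⟩ := exists_minPoint_erase_mem (strictConvexOn_sum_sq d) (by fun_prop)
      (H c f) T (by simpa using hT)
      (fun a _ => ((Set.toFinite _).image _).isCompact_convexHull ℝ)
      (fun a _ => convex_convexHull ℝ _) ⟨z, Set.mem_iInter₂.2 fun a _ => hz a⟩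
    exact ⟨(c, a), ha⟩)
  obtain ⟨f, hf⟩ := exists_le_tupleWeight_of_diagonal hw hw1 {b | c b = a} (Q (c, a)) (by
    intro f f' g g' hf hg h
    have h1 : (⋂ j ∈ T.erase a, H c f j) = ⋂ j ∈ T.erase a, H c f' j := by
      refine Set.iInter₂_congr fun j hj => hH c f f' j fun b hb => hf b ?_
      change c b ≠ a
      rw [hb]
      exact Finset.ne_of_mem_erase hj
    simpa only [Q, h1, hH c g g' a fun b hb => hg b hb] using h) hca
  refine ⟨minPoint q (⋂ j ∈ T.erase a, H c f j), hf.trans (tupleWeight_mono hw fun g hg => ?_)⟩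
  exact convexHull_mono (Set.image_subset_range _ _) hg

/-- Weak `ε`-nets for convex sets exist with size bounded in terms of `ε` and the dimension. -/
theorem exists_weak_net (d : ℕ) {ε : ℝ} (hε : 0 < ε) :
    ∃ n : ℕ, ∀ (κ : Type) [Fintype κ] (x : κ → Fin d → ℝ) (w : κ → ℝ), (∀ k, 0 ≤ w k) →
      ∑ k, w k = 1 → ∃ N : Finset (Fin d → ℝ), N.card ≤ n ∧
        ∀ C : Set (Fin d → ℝ), Convex ℝ C → ε ≤ ∑ k, (x ⁻¹' C).indicator w k →
          ∃ y ∈ N, y ∈ C := by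
  classical
  obtain ⟨B, _, c, hc, hsel⟩ := exists_mem_convexHull_tuples d
  let δ := c * ε ^ Fintype.card B
  have hδ : 0 < δ := by positivity
  obtain ⟨n, hn⟩ := exists_nat_gt (1 / δ)
  rw [div_lt_iff₀ hδ] at hn
  refine ⟨n, fun κ _ x w hw hw1 => ?_⟩
  let cov : Finset (Fin d → ℝ) → Set (B → κ) := fun N =>
    {f | ∃ y ∈ N, y ∈ convexHull ℝ (Set.range (x ∘ f))}
  by_contra! hno
  have hgrow : ∀ m ≤ n, ∃ N : Finset (Fin d → ℝ), N.card ≤ m ∧ m * δ ≤ tupleWeight w (cov N) := by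
    intro m
    induction m with
    | zero =>
      refine fun _ => ⟨∅, by simp, ?_⟩
      rw [Nat.cast_zero, zero_mul]
      exact Finset.sum_nonneg fun f _ => Set.indicator_nonneg
        (fun f _ => Finset.prod_nonneg fun _ _ => hw _) f
    | succ m ih =>
      intro hm
      obtain ⟨N, hN, hcov⟩ := ih (by omega)
      obtain ⟨C, hC, hCε, hmiss⟩ := hno N (by omega)
      set a := ∑ k, (x ⁻¹' C).indicator w k with ha
      have ha0 : 0 < a := hε.trans_le hCε
      obtain ⟨z, hz⟩ := hsel κ x (fun k => (x ⁻¹' C).indicator w k / a)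
        (fun k => div_nonneg (Set.indicator_nonneg (fun k _ => hw k) k) ha0.le)
        (by rw [← Finset.sum_div, ← ha, div_self ha0.ne'])
      rw [tupleWeight_indicator_div, le_div_iff₀ (by positivity)] at hz
      refine ⟨insert z N, (Finset.card_insert_le _ _).trans (by omega), ?_⟩
      have hpow : δ ≤ c * a ^ Fintype.card B := by
        simp only [δ]
        gcongr
      set D : Set (B → κ) := {f | f ∈ {f : B → κ | z ∈ convexHull ℝ (Set.range (x ∘ f))} ∧
        ∀ b, f b ∈ x ⁻¹' C} with hD
      have hdisj : Disjoint (cov N) D := by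
        rw [Set.disjoint_left]
        rintro f ⟨y, hy, hyf⟩ ⟨-, hf⟩
        exact hmiss y hy (convexHull_min (by rintro _ ⟨b, rfl⟩; exact hf b) hC hyf)
      have hsub : cov N ∪ D ⊆ cov (insert z N) := by
        rintro f (⟨y, hy, hyf⟩ | ⟨hf, -⟩)
        · exact ⟨y, Finset.mem_insert_of_mem hy, hyf⟩
        · exact ⟨z, Finset.mem_insert_self _ _, hf⟩
      have h1 := tupleWeight_mono hw hsub
      rw [tupleWeight_union hdisj] at h1
      push_cast
      linarith
  obtain ⟨N, -, hN⟩ := hgrow n le_rfl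
  have h1 := tupleWeight_mono hw (Set.subset_univ (cov N))
  rw [tupleWeight_univ hw1] at h1
  linarith

/-- Linear programming duality for transversals: if every weighting of the members has a point of
depth `β`, then some weighting of points gives every member mass at least `β`. -/
theorem exists_weights_of_forall_weights {ι E : Type} [Fintype ι] [Nonempty E] (F : ι → Set E) {β : ℝ}
    (h : ∀ w : ι → ℝ, (∀ i, 0 ≤ w i) → ∑ i, w i = 1 →
      ∃ x, β ≤ ∑ i, {i | x ∈ F i}.indicator w i) :
    ∃ (κ : Type) (_ : Fintype κ) (x : κ → E) (w : κ → ℝ), (∀ k, 0 ≤ w k) ∧ ∑ k, w k = 1 ∧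
      ∀ i, β ≤ ∑ k, (x ⁻¹' F i).indicator w k := by
  classical
  let v : E → ι → ℝ := fun x i => if x ∈ F i then 1 else 0
  have hfin : (Set.range v).Finite := by
    refine (Set.Finite.pi' (t := fun _ : ι => ({0, 1} : Set ℝ))
      fun _ => Set.toFinite _).subset ?_
    rintro _ ⟨x, rfl⟩ i
    by_cases hx : x ∈ F i <;> simp [v, hx]
  by_cases hdisj : Disjoint (convexHull ℝ (Set.range v)) (Set.Ici fun _ => β)
  · exfalso
    obtain ⟨f, u, u', hu, huu, hu'⟩ := geometric_hahn_banach_compact_closed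
      (convex_convexHull ℝ _) (hfin.isCompact_convexHull ℝ) (convex_Ici _) isClosed_Ici hdisj
    let a : ι → ℝ := fun i => f (Pi.single i 1)
    have hf : ∀ y : ι → ℝ, f y = ∑ i, y i * a i := fun y => by
      conv_lhs => rw [pi_eq_sum_univ' y]
      simp [a, map_sum]
    have ha : ∀ i, 0 ≤ a i := by
      intro i
      by_contra! hneg
      have hβ := hu' (fun _ => β) Set.self_mem_Ici
      let s := (f (fun _ => β) - u') / (-a i)
      have hs : 0 ≤ s := div_nonneg (by linarith) (by linarith)
      have := hu' ((fun _ => β) + s • Pi.single i (1 : ℝ)) (by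
        refine Set.mem_Ici.2 (le_add_of_nonneg_right ?_)
        exact smul_nonneg hs (Pi.single_nonneg.2 zero_le_one))
      rw [map_add, map_smul, smul_eq_mul] at this
      have hsa : s * f (Pi.single i 1) = -(f (fun _ => β) - u') := by
        change s * a i = _
        rw [div_mul_eq_mul_div, div_neg, mul_div_cancel_right₀ _ hneg.ne]
      linarith
    have hsum : 0 ≤ ∑ i, a i := Finset.sum_nonneg fun i _ => ha i
    have hβ := hu' (fun _ => β) Set.self_mem_Ici
    rw [hf, ← Finset.mul_sum] at hβ
    rcases hsum.eq_or_lt with h0 | hpos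
    · have ha0 : ∀ i, a i = 0 := fun i =>
        (Finset.sum_eq_zero_iff_of_nonneg fun i _ => ha i).1 h0.symm i (Finset.mem_univ i)
      have hf0 : ∀ y, f y = 0 := fun y => by simp [hf, ha0]
      obtain ⟨y, hy⟩ : (convexHull ℝ (Set.range v)).Nonempty :=
        (Set.range_nonempty v).convexHull
      have := hu y hy
      rw [hf0] at this
      rw [← h0, mul_zero] at hβ
      linarith
    · obtain ⟨x, hx⟩ := h (fun i => a i / ∑ i, a i) (fun i => div_nonneg (ha i) hsum)
        (by rw [← Finset.sum_div, div_self hpos.ne'])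
      have h1 := hu (v x) (subset_convexHull ℝ _ ⟨x, rfl⟩)
      have h2 : ∑ i, {i | x ∈ F i}.indicator (fun i => a i / ∑ i, a i) i
          = f (v x) / ∑ i, a i := by
        rw [hf, Finset.sum_div]
        refine Finset.sum_congr rfl fun i _ => ?_
        by_cases hx : x ∈ F i <;> simp [v, hx]
      rw [h2, le_div_iff₀ hpos] at hx
      linarith
  · obtain ⟨y, hy, hβ⟩ := Set.not_disjoint_iff.1 hdisj
    obtain ⟨κ, _, w, z, hw, hw1, hz, hsum⟩ := mem_convexHull_iff_exists_fintype.1 hy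
    choose x hx using hz
    refine ⟨κ, inferInstance, x, w, hw, hw1, fun i => (hβ i).trans_eq ?_⟩
    rw [← hsum, Finset.sum_apply]
    refine Finset.sum_congr rfl fun k _ => ?_
    by_cases hk : x k ∈ F i <;> simp [← hx k, v, hk]

/-- Under the hypotheses of the main theorem, every weighting of the family has a deep point. -/
theorem exists_deep_point (d t p : ℕ) :
    ∃ β : ℝ, 0 < β ∧ ∀ (ι : Type) [Fintype ι] (F : ι → Set (Fin d → ℝ)),
      (∀ i, (F i).Nonempty) → (∀ i, IsCompact (F i)) → (∀ i, Convex ℝ (F i)) →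
      (∀ S : Finset ι, (∀ i ∈ S, ∀ j ∈ S, (F i ∩ F j).Nonempty) →
        ∃ P : Finset (Fin d → ℝ), P.card ≤ t ∧ ∀ i ∈ S, ∃ x ∈ P, x ∈ F i) →
      HasPQ F p 2 → ∀ w : ι → ℝ, (∀ i, 0 ≤ w i) → ∑ i, w i = 1 →
        ∃ x, β ≤ ∑ i, {i | x ∈ F i}.indicator w i := by
  classical
  obtain ⟨N, hN⟩ := exists_ramsey p (t * d + 1)
  refine ⟨1 / ((Fintype.card (Finset (Fin N) × Fin N) : ℝ) + 1), by positivity, ?_⟩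
  intro ι _ F hne hcomp hconv htwo hpq w hw hw1
  let q : (Fin d → ℝ) → ℝ := fun x => ∑ i, x i ^ 2
  have hcommon : ∀ f : Fin N → ι, ∃ T : Finset (Fin N), T.card = d + 1 ∧
      (⋂ k ∈ T, F (f k)).Nonempty := by
    intro f
    rcases hN (Fin N) (fun a b => (F (f a) ∩ F (f b)).Nonempty)
      (fun h => by rwa [Set.inter_comm]) Finset.univ (by simp) with
      ⟨S, -, hS, hpw⟩ | ⟨S, -, hS, hpw⟩
    · exfalso
      have hinj : Set.InjOn f S := by
        intro a ha b hb hab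
        by_contra hne'
        refine hpw ha hb hne' ?_
        rw [hab, Set.inter_self]
        exact hne _
      obtain ⟨K, hKS, hK, y, hy⟩ := hpq.2 (S.image f) (by rw [Finset.card_image_of_injOn hinj, hS])
      obtain ⟨i, j, hij, rfl⟩ := Finset.card_eq_two.1 hK
      obtain ⟨a, ha, rfl⟩ := Finset.mem_image.1 (hKS (Finset.mem_insert_self _ _))
      obtain ⟨b, hb, rfl⟩ := Finset.mem_image.1 (hKS (Finset.mem_insert_of_mem
        (Finset.mem_singleton_self _)))
      rw [Set.mem_iInter₂] at hy
      exact hpw ha hb (fun h => hij (by rw [h])) ⟨y, hy _ (by simp), hy _ (by simp)⟩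
    · obtain ⟨P, hP, hpierce⟩ := htwo (S.image f) (by
        intro i hi j hj
        obtain ⟨a, ha, rfl⟩ := Finset.mem_image.1 hi
        obtain ⟨b, hb, rfl⟩ := Finset.mem_image.1 hj
        by_cases hab : a = b
        · subst hab
          rw [Set.inter_self]
          exact hne _
        · exact hpw ha hb hab)
      have hpt : ∀ a : Fin N, ∃ x, a ∈ S → x ∈ P ∧ x ∈ F (f a) := by
        intro a
        by_cases ha : a ∈ S
        · obtain ⟨x, hx⟩ := hpierce (f a) (Finset.mem_image_of_mem f ha)
          exact ⟨x, fun _ => hx⟩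
        · exact ⟨0, fun h => absurd h ha⟩
      choose x hx using hpt
      obtain ⟨y, -, hy⟩ := Finset.exists_lt_card_fiber_of_mul_lt_card_of_maps_to
        (s := S) (t := P) (f := x) (n := d) (fun a ha => (hx a ha).1)
        (by rw [hS]; exact Nat.lt_succ_of_le (Nat.mul_le_mul_right d hP))
      obtain ⟨T, hTS, hT⟩ := Finset.exists_subset_card_eq (Nat.succ_le_of_lt hy)
      refine ⟨T, hT, y, Set.mem_iInter₂.2 fun a ha => ?_⟩
      obtain ⟨haS, rfl⟩ := Finset.mem_filter.1 (hTS ha)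
      exact (hx a haS).2
  let Q : Finset (Fin N) × Fin N → (Fin N → ι) → (Fin N → ι) → Prop := fun Tk f g =>
    minPoint q (⋂ j ∈ Tk.1.erase Tk.2, F (f j)) ∈ F (g Tk.2)
  obtain ⟨⟨T, k⟩, hTk⟩ := exists_inv_card_le_tupleWeight hw hw1 (fun Tk f => Q Tk f f) (by
    intro f
    obtain ⟨T, hT, hTne⟩ := hcommon f
    obtain ⟨k, -, hk⟩ := exists_minPoint_erase_mem (strictConvexOn_sum_sq d) (by fun_prop)
      (fun k => F (f k)) T (by simpa using hT) (fun k _ => hcomp _) (fun k _ => hconv _) hTne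
    exact ⟨(T, k), hk⟩)
  obtain ⟨f, hf⟩ := exists_le_tupleWeight_of_diagonal hw hw1 {k} (Q (T, k)) (by
    intro f f' g g' hf hg h
    have h1 : (⋂ j ∈ T.erase k, F (f j)) = ⋂ j ∈ T.erase k, F (f' j) :=
      Set.iInter₂_congr fun j hj => by rw [hf j (by simpa using Finset.ne_of_mem_erase hj)]
    simpa only [Q, h1, hg k rfl] using h) hTk
  exact ⟨_, hf.trans_eq
    (tupleWeight_coord hw1 k {i | minPoint q (⋂ j ∈ T.erase k, F (f j)) ∈ F i})⟩

/-- Theorem 1.8(1): for all `d ≥ 1`, `t ≥ 1`, `p ≥ 2` there exists `s = s(p,d,t)`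
such that every finite family of nonempty compact convex sets in `ℝ^d` in which
every pairwise-intersecting subfamily can be pierced by `t` points (a
`(2,2)`-theorem with constant `t`) and which satisfies the `(p,2)`-property can
be pierced by at most `s` points. -/
theorem twotwo_to_p2_general (d t p : ℕ) (hd : 1 ≤ d) (ht : 1 ≤ t) (hp : 2 ≤ p) :
    ∃ s : ℕ,
      ∀ (ι : Type) [Fintype ι], ∀ F : ι → Set (Fin d → ℝ),
        (∀ i, (F i).Nonempty) →
        (∀ i, IsCompact (F i)) →
        (∀ i, Convex ℝ (F i)) →
        (∀ S : Finset ι, (∀ i ∈ S, ∀ j ∈ S, (F i ∩ F j).Nonempty) →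
          ∃ P : Finset (Fin d → ℝ), P.card ≤ t ∧ ∀ i ∈ S, ∃ x ∈ P, x ∈ F i) →
        HasPQ F p 2 →
        ∃ P : Finset (Fin d → ℝ), P.card ≤ s ∧ Pierces F P := by
  obtain ⟨β, hβ, hdeep⟩ := exists_deep_point d t p
  obtain ⟨s, hs⟩ := exists_weak_net d hβ
  refine ⟨s, fun ι _ F hne hcomp hconv htwo hpq => ?_⟩
  obtain ⟨κ, _, x, w, hw, hw1, hmass⟩ :=
    exists_weights_of_forall_weights F (hdeep ι F hne hcomp hconv htwo hpq)
  obtain ⟨P, hP, hnet⟩ := hs κ x w hw hw1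
  exact ⟨P, hP, fun i => hnet (F i) (hconv i) (hmass i)⟩
end
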